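/- Let F_0 and F_1 be classes of unimodal Kripke frames (in disjoint signatures {0} and {1}) closed under isomorphic copies and disjoint unions. If ∘←∘→∘ is a subframe of F_0 and ∘→∘ is a subframe of F_1, then the μ-calculus' alternation hierarchy is strict over the fusion F_0 ⊗ F_1: for every n ∈ ℕ there is a μ-formula in Σ^μ_{n+1} ∪ Π^μ_{n+1} which is not equivalent over F_0 ⊗ F_1 to any μ-formula in Σ^μ_n ∪ Π^μ_n. -/

import Mathlib

/- ### μ-calculus: syntax and Kripke semantics -/

/-- μ-formulas over a modal signature `Λ`, with propositional symbols and
variables indexed by `ℕ`; negation applies to propositional symbols only. -/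
inductive MuForm (Λ : Type) : Type where
  | prop : ℕ → MuForm Λ
  | nprop : ℕ → MuForm Λ
  | var : ℕ → MuForm Λ
  | and : MuForm Λ → MuForm Λ → MuForm Λ
  | or : MuForm Λ → MuForm Λ → MuForm Λ
  | box : Λ → MuForm Λ → MuForm Λ
  | dia : Λ → MuForm Λ → MuForm Λ
  | mu : ℕ → MuForm Λ → MuForm Λ
  | nu : ℕ → MuForm Λ → MuForm Λ

/-- A Kripke model over signature `Λ` with set of worlds `W`. -/
structure KModel (Λ W : Type) where
  R : Λ → W → W → Prop
  V : ℕ → Set W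

namespace MuForm

variable {Λ W : Type}

/-- The valuation `‖φ‖^M` of a μ-formula, where `env` interprets the variables;
least and greatest fixed points are taken in the complete lattice `Set W`. -/
def sem (M : KModel Λ W) (env : ℕ → Set W) : MuForm Λ → Set W
  | prop p => M.V p
  | nprop p => (M.V p)ᶜ
  | var x => env x
  | and a b => sem M env a ∩ sem M env b
  | or a b => sem M env a ∪ sem M env b
  | box i a => {w | ∀ v, M.R i w v → v ∈ sem M env a}
  | dia i a => {w | ∃ v, M.R i w v ∧ v ∈ sem M env a}
  | mu x a => sInf {A : Set W | sem M (Function.update env x A) a ⊆ A}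
  | nu x a => sSup {A : Set W | A ⊆ sem M (Function.update env x A) a}

/-- Free variables of a μ-formula. -/
def freeVars : MuForm Λ → Set ℕ
  | prop _ => ∅
  | nprop _ => ∅
  | var x => {x}
  | and a b => freeVars a ∪ freeVars b
  | or a b => freeVars a ∪ freeVars b
  | box _ a => freeVars a
  | dia _ a => freeVars a
  | mu x a => freeVars a \ {x}
  | nu x a => freeVars a \ {x}

/-- A μ-formula contains no fixed-point operators. -/
def noFix : MuForm Λ → Prop
  | prop _ => True
  | nprop _ => True
  | var _ => True
  | and a b => noFix a ∧ noFix b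
  | or a b => noFix a ∧ noFix b
  | box _ a => noFix a
  | dia _ a => noFix a
  | mu _ _ => False
  | nu _ _ => False

/-- The list of subformulas of a μ-formula. -/
def subfs : MuForm Λ → List (MuForm Λ)
  | prop p => [prop p]
  | nprop p => [nprop p]
  | var x => [var x]
  | and a b => (and a b) :: (subfs a ++ subfs b)
  | or a b => (or a b) :: (subfs a ++ subfs b)
  | box i a => (box i a) :: subfs a
  | dia i a => (dia i a) :: subfs a
  | mu x a => (mu x a) :: subfs a
  | nu x a => (nu x a) :: subfs a

/-- Substitution of `ψ` for the free occurrences of the variable `X`. -/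
def subst (X : ℕ) (ψ : MuForm Λ) : MuForm Λ → MuForm Λ
  | prop p => prop p
  | nprop p => nprop p
  | var y => if y = X then ψ else var y
  | and a b => and (subst X ψ a) (subst X ψ b)
  | or a b => or (subst X ψ a) (subst X ψ b)
  | box i a => box i (subst X ψ a)
  | dia i a => dia i (subst X ψ a)
  | mu y a => if y = X then mu y a else mu y (subst X ψ a)
  | nu y a => if y = X then nu y a else nu y (subst X ψ a)

/-- The substitution of `ψ` for `X` is capture-free: no free variable of `ψ`
becomes bound when substituting `ψ` for the free occurrences of `X`. -/
def CaptureFree (X : ℕ) (ψ : MuForm Λ) : MuForm Λ → Prop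
  | prop _ => True
  | nprop _ => True
  | var _ => True
  | and a b => CaptureFree X ψ a ∧ CaptureFree X ψ b
  | or a b => CaptureFree X ψ a ∧ CaptureFree X ψ b
  | box _ a => CaptureFree X ψ a
  | dia _ a => CaptureFree X ψ a
  | mu y a => y = X ∨ ((X ∈ freeVars a → y ∉ freeVars ψ) ∧ CaptureFree X ψ a)
  | nu y a => y = X ∨ ((X ∈ freeVars a → y ∉ freeVars ψ) ∧ CaptureFree X ψ a)

/-- Number of occurrences of the variable `X`. -/
def varCnt (X : ℕ) : MuForm Λ → ℕ
  | prop _ => 0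
  | nprop _ => 0
  | var y => if y = X then 1 else 0
  | and a b => varCnt X a + varCnt X b
  | or a b => varCnt X a + varCnt X b
  | box _ a => varCnt X a
  | dia _ a => varCnt X a
  | mu _ a => varCnt X a
  | nu _ a => varCnt X a

/-- Number of fixed-point binders binding the variable `X`. -/
def bndCnt (X : ℕ) : MuForm Λ → ℕ
  | prop _ => 0
  | nprop _ => 0
  | var _ => 0
  | and a b => bndCnt X a + bndCnt X b
  | or a b => bndCnt X a + bndCnt X b
  | box _ a => bndCnt X a
  | dia _ a => bndCnt X a
  | mu y a => (if y = X then 1 else 0) + bndCnt X a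
  | nu y a => (if y = X then 1 else 0) + bndCnt X a

end MuForm

/-- Each variable has at most one occurrence, is bound by at most one
fixed-point operator, and no variable occurs free. -/
def WellNamed {Λ : Type} (φ : MuForm Λ) : Prop :=
  (∀ X : ℕ, MuForm.varCnt X φ ≤ 1 ∧ MuForm.bndCnt X φ ≤ 1) ∧ MuForm.freeVars φ = ∅

/- ### The alternation hierarchy Σ^μ_n / Π^μ_n -/

mutual
  /-- The class `Σ^μ_n` of the alternation hierarchy. -/
  inductive SigmaMu {Λ : Type} : ℕ → MuForm Λ → Prop where
    | base {φ : MuForm Λ} : φ.noFix → SigmaMu 0 φ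
    | upS {n : ℕ} {φ : MuForm Λ} : SigmaMu n φ → SigmaMu (n + 1) φ
    | upP {n : ℕ} {φ : MuForm Λ} : PiMu n φ → SigmaMu (n + 1) φ
    | andI {n : ℕ} {a b : MuForm Λ} :
        SigmaMu (n + 1) a → SigmaMu (n + 1) b → SigmaMu (n + 1) (MuForm.and a b)
    | orI {n : ℕ} {a b : MuForm Λ} :
        SigmaMu (n + 1) a → SigmaMu (n + 1) b → SigmaMu (n + 1) (MuForm.or a b)
    | boxI {n : ℕ} {i : Λ} {a : MuForm Λ} :
        SigmaMu (n + 1) a → SigmaMu (n + 1) (MuForm.box i a)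
    | diaI {n : ℕ} {i : Λ} {a : MuForm Λ} :
        SigmaMu (n + 1) a → SigmaMu (n + 1) (MuForm.dia i a)
    | muI {n : ℕ} {X : ℕ} {a : MuForm Λ} :
        SigmaMu (n + 1) a → SigmaMu (n + 1) (MuForm.mu X a)
    | substI {n : ℕ} {X : ℕ} {a ψ : MuForm Λ} :
        SigmaMu (n + 1) a → SigmaMu (n + 1) ψ → MuForm.CaptureFree X ψ a →
        SigmaMu (n + 1) (MuForm.subst X ψ a)

  /-- The class `Π^μ_n` of the alternation hierarchy. -/
  inductive PiMu {Λ : Type} : ℕ → MuForm Λ → Prop where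
    | base {φ : MuForm Λ} : φ.noFix → PiMu 0 φ
    | upS {n : ℕ} {φ : MuForm Λ} : SigmaMu n φ → PiMu (n + 1) φ
    | upP {n : ℕ} {φ : MuForm Λ} : PiMu n φ → PiMu (n + 1) φ
    | andI {n : ℕ} {a b : MuForm Λ} :
        PiMu (n + 1) a → PiMu (n + 1) b → PiMu (n + 1) (MuForm.and a b)
    | orI {n : ℕ} {a b : MuForm Λ} :
        PiMu (n + 1) a → PiMu (n + 1) b → PiMu (n + 1) (MuForm.or a b)
    | boxI {n : ℕ} {i : Λ} {a : MuForm Λ} :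
        PiMu (n + 1) a → PiMu (n + 1) (MuForm.box i a)
    | diaI {n : ℕ} {i : Λ} {a : MuForm Λ} :
        PiMu (n + 1) a → PiMu (n + 1) (MuForm.dia i a)
    | nuI {n : ℕ} {X : ℕ} {a : MuForm Λ} :
        PiMu (n + 1) a → PiMu (n + 1) (MuForm.nu X a)
    | substI {n : ℕ} {X : ℕ} {a ψ : MuForm Λ} :
        PiMu (n + 1) a → PiMu (n + 1) ψ → MuForm.CaptureFree X ψ a →
        PiMu (n + 1) (MuForm.subst X ψ a)
end

/- ### Kripke frames, closure conditions, fusions, equivalence -/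

/-- A Kripke frame over the signature `Λ`. -/
structure Frame (Λ : Type) : Type 1 where
  World : Type
  R : Λ → World → World → Prop

/-- Frame isomorphism. -/
def FrameIso {Λ : Type} (F G : Frame Λ) : Prop :=
  ∃ e : F.World ≃ G.World, ∀ (i : Λ) (w v : F.World), F.R i w v ↔ G.R i (e w) (e v)

/-- A class of frames is closed under isomorphic copies. -/
def ClosedUnderIso {Λ : Type} (C : Set (Frame Λ)) : Prop :=
  ∀ F ∈ C, ∀ G : Frame Λ, FrameIso F G → G ∈ C

/-- Disjoint union of a family of frames. -/
def Frame.disjUnion {Λ ι : Type} (f : ι → Frame Λ) : Frame Λ where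
  World := Σ i : ι, (f i).World
  R m x y :=
    ∃ h : x.1 = y.1, (f y.1).R m (cast (congrArg (fun i => (f i).World) h) x.2) y.2

/-- A class of frames is closed under disjoint unions. -/
def ClosedUnderDU {Λ : Type} (C : Set (Frame Λ)) : Prop :=
  ∀ (ι : Type) (f : ι → Frame Λ), (∀ i, f i ∈ C) → Frame.disjUnion f ∈ C

/-- `∘→∘` is a subframe of the class `C` of unimodal frames. -/
def HasEdge (C : Set (Frame Unit)) : Prop :=
  ∃ F ∈ C, ∃ w0 w1 : F.World, w0 ≠ w1 ∧ F.R () w0 w1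

/-- `∘←∘→∘` is a subframe of the class `C` of unimodal frames. -/
def HasFork (C : Set (Frame Unit)) : Prop :=
  ∃ F ∈ C, ∃ w0 w1 w2 : F.World,
    w0 ≠ w1 ∧ w0 ≠ w2 ∧ w1 ≠ w2 ∧ F.R () w0 w1 ∧ F.R () w0 w2

/-- `∘→∘→∘` is a subframe of the class `C` of unimodal frames. -/
def HasChain2 (C : Set (Frame Unit)) : Prop :=
  ∃ F ∈ C, ∃ w0 w1 w2 : F.World,
    w0 ≠ w1 ∧ w0 ≠ w2 ∧ w1 ≠ w2 ∧ F.R () w0 w1 ∧ F.R () w1 w2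

/-- The unimodal reduct of a bimodal frame. -/
def Frame.reduct2 (F : Frame (Fin 2)) (i : Fin 2) : Frame Unit :=
  ⟨F.World, fun _ => F.R i⟩

/-- Fusion of two classes of unimodal frames (signatures `{0}` and `{1}`). -/
def fusion2 (C0 C1 : Set (Frame Unit)) : Set (Frame (Fin 2)) :=
  {F | F.reduct2 0 ∈ C0 ∧ F.reduct2 1 ∈ C1}

/-- The unimodal reduct of a trimodal frame. -/
def Frame.reduct3 (F : Frame (Fin 3)) (i : Fin 3) : Frame Unit :=
  ⟨F.World, fun _ => F.R i⟩

/-- Fusion of three classes of unimodal frames. -/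
def fusion3 (C0 C1 C2 : Set (Frame Unit)) : Set (Frame (Fin 3)) :=
  {F | F.reduct3 0 ∈ C0 ∧ F.reduct3 1 ∈ C1 ∧ F.reduct3 2 ∈ C2}

/-- Two μ-formulas are equivalent over a class of frames: they have the same
valuation in every model based on a frame of the class. -/
def EquivOver {Λ : Type} (C : Set (Frame Λ)) (φ ψ : MuForm Λ) : Prop :=
  ∀ F ∈ C, ∀ (V : ℕ → Set F.World) (env : ℕ → Set F.World),
    MuForm.sem ⟨F.R, V⟩ env φ = MuForm.sem ⟨F.R, V⟩ env ψ

/- ### Games, strategies, evaluation games, parity games -/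

/-- A two-player game on a graph: positions owned by `ownV` belong to
Verifier/∃, the others to Refuter/∀; `winV` decides infinite plays.
A player who cannot move loses. -/
structure Game (Pos : Type) where
  init : Pos
  ownV : Pos → Prop
  move : Pos → Pos → Prop
  winV : (ℕ → Pos) → Prop

/-- The history (current position first) of an infinite play after `n` steps. -/
def histN {Pos : Type} (p : ℕ → Pos) (n : ℕ) : List Pos :=
  ((List.range (n + 1)).map p).reverse

/-- Finite histories (current position first) of plays in which the player
owning the `own`-positions follows the strategy `σ`. -/
inductive Game.Hist {Pos : Type} (G : Game Pos) (own : Pos → Prop)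
    (σ : List Pos → Pos) : List Pos → Prop where
  | init : Game.Hist G own σ [G.init]
  | smove {l : List Pos} {x : Pos} : Game.Hist G own σ (x :: l) → own x →
      G.move x (σ (x :: l)) → Game.Hist G own σ (σ (x :: l) :: x :: l)
  | omove {l : List Pos} {x y : Pos} : Game.Hist G own σ (x :: l) → ¬ own x →
      G.move x y → Game.Hist G own σ (y :: x :: l)

/-- The player owning the `own`-positions has a winning strategy:
a strategy which always provides a legal move at reachable own positions
(so the player is never stuck) and such that every infinite play following it
satisfies the winning condition `winO`; finite plays in which the opponent is
stuck are automatically won. -/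
def Game.WinsFor {Pos : Type} (G : Game Pos) (own : Pos → Prop)
    (winO : (ℕ → Pos) → Prop) : Prop :=
  ∃ σ : List Pos → Pos,
    (∀ (l : List Pos) (x : Pos), G.Hist own σ (x :: l) → own x →
      G.move x (σ (x :: l))) ∧
    (∀ p : ℕ → Pos, p 0 = G.init → (∀ n, G.move (p n) (p (n + 1))) →
      (∀ n, own (p n) → p (n + 1) = σ (histN p n)) → winO p)

/-- Verifier has a winning strategy. -/
def Game.VWins {Pos : Type} (G : Game Pos) : Prop := G.WinsFor G.ownV G.winV

/-- Refuter has a winning strategy. -/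
def Game.RWins {Pos : Type} (G : Game Pos) : Prop :=
  G.WinsFor (fun x => ¬ G.ownV x) (fun p => ¬ G.winV p)

/-- Ownership of positions in the evaluation game `𝒢(M, w ⊨ φ0)`:
Verifier owns disjunctions, diamonds, μ-formulas, μ-bound variables and
false literals. -/
def evalOwnV {Λ W : Type} (M : KModel Λ W) (φ0 : MuForm Λ) :
    MuForm Λ × W → Prop := fun q =>
  match q with
  | (.or _ _, _) => True
  | (.dia _ _, _) => True
  | (.mu _ _, _) => True
  | (.var X, _) => ∃ a : MuForm Λ, (MuForm.mu X a) ∈ φ0.subfs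
  | (.prop p, w) => w ∉ M.V p
  | (.nprop p, w) => w ∈ M.V p
  | _ => False

/-- Admissible moves in the evaluation game `𝒢(M, w ⊨ φ0)`. -/
def evalMove {Λ W : Type} (M : KModel Λ W) (φ0 : MuForm Λ) :
    MuForm Λ × W → MuForm Λ × W → Prop := fun q r =>
  match q with
  | (.and a b, w) => r = (a, w) ∨ r = (b, w)
  | (.or a b, w) => r = (a, w) ∨ r = (b, w)
  | (.box i a, w) => ∃ v, M.R i w v ∧ r = (a, v)
  | (.dia i a, w) => ∃ v, M.R i w v ∧ r = (a, v)
  | (.mu _ a, w) => r = (a, w)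
  | (.nu _ a, w) => r = (a, w)
  | (.var X, w) =>
      ∃ a : MuForm Λ,
        ((MuForm.mu X a) ∈ φ0.subfs ∧ r = (MuForm.mu X a, w)) ∨
        ((MuForm.nu X a) ∈ φ0.subfs ∧ r = (MuForm.nu X a, w))
  | (.prop _, _) => False
  | (.nprop _, _) => False

/-- The formula `ψ` labels infinitely many positions of the infinite run `p`. -/
def InfOccF {Λ W : Type} (p : ℕ → MuForm Λ × W) (ψ : MuForm Λ) : Prop :=
  ∀ n, ∃ m, n ≤ m ∧ (p m).1 = ψ

/-- Verifier wins an infinite run iff the outermost fixed-point subformula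
occurring infinitely often is a ν-formula. -/
def evalWinV {Λ W : Type} (p : ℕ → MuForm Λ × W) : Prop :=
  ∃ (X : ℕ) (a : MuForm Λ), InfOccF p (MuForm.nu X a) ∧
    ∀ χ : MuForm Λ, InfOccF p χ → χ ∈ (MuForm.nu X a).subfs

/-- The evaluation game `𝒢(M, w ⊨ φ)`. -/
def evalGame {Λ W : Type} (M : KModel Λ W) (w : W) (φ : MuForm Λ) :
    Game (MuForm Λ × W) where
  init := (φ, w)
  ownV := evalOwnV M φ
  move := evalMove M φ
  winV := evalWinV

/-- A parity game. -/
structure PGame : Type 1 where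
  Pos : Type
  ownE : Pos → Prop
  init : Pos
  E : Pos → Pos → Prop
  Ω : Pos → ℕ

/-- The parity `k` occurs infinitely often in the infinite play `p`. -/
def InfOccPar (P : PGame) (p : ℕ → P.Pos) (k : ℕ) : Prop :=
  ∀ n, ∃ m, n ≤ m ∧ P.Ω (p m) = k

/-- A parity game as a game: ∃ wins an infinite play iff the greatest parity
occurring infinitely often is even. -/
def PGame.toGame (P : PGame) : Game P.Pos where
  init := P.init
  ownV := P.ownE
  move := P.E
  winV := fun p => ∃ k, Even k ∧ InfOccPar P p k ∧ ∀ j, InfOccPar P p j → j ≤ k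

/-- Player ∃ wins the parity game. -/
def PGame.ExWins (P : PGame) : Prop := P.toGame.VWins

/-- Player ∀ wins the parity game. -/
def PGame.AWins (P : PGame) : Prop := P.toGame.RWins

/-- The parity of a fixed-point formula: `2(i+ε) − 1` for a μ-formula in
`Σ^μ_{2i+ε} \ Π^μ_{2i+ε}`, `2i` for a ν-formula in `Π^μ_{2i+ε} \ Σ^μ_{2i+ε}`,
and `0` for non fixed-point formulas. -/
noncomputable def fpParity {Λ : Type} : MuForm Λ → ℕ := fun φ =>
  match φ with
  | .mu _ _ =>
      (fun ℓ => if Even ℓ then ℓ - 1 else ℓ) (sInf {k | SigmaMu k φ ∧ ¬ PiMu k φ})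
  | .nu _ _ =>
      (fun ℓ => if Even ℓ then ℓ else ℓ - 1) (sInf {k | PiMu k φ ∧ ¬ SigmaMu k φ})
  | _ => 0

/-- The evaluation game `𝒢(M, w ⊨ φ)` presented as the parity game
`𝒢^P(M, w ⊨ φ)`. -/
noncomputable def evalPGame {Λ W : Type} (M : KModel Λ W) (w : W)
    (φ : MuForm Λ) : PGame where
  Pos := MuForm Λ × W
  ownE := evalOwnV M φ
  init := (φ, w)
  E := evalMove M φ
  Ω := fun q => fpParity q.1

/- ### Tree unfolding of a parity game -/

/-- Finite `E`-paths of a parity game starting at the initial position,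
presented as (last vertex, reversed list of earlier vertices). -/
inductive IsUPath (P : PGame) : P.Pos × List P.Pos → Prop where
  | init : IsUPath P (P.init, [])
  | cons {u : P.Pos} {t : List P.Pos} {v : P.Pos} :
      IsUPath P (u, t) → P.E u v → IsUPath P (v, u :: t)

/-- The tree unfolding of a parity game: positions are the finite `E`-paths
starting at the initial position, with ownership and parity inherited from
the last vertex. -/
def PGame.unfold (P : PGame) : PGame where
  Pos := {q : P.Pos × List P.Pos // IsUPath P q}
  ownE := fun q => P.ownE q.val.1
  init := ⟨(P.init, []), IsUPath.init⟩
  E := fun q r => r.val.2 = q.val.1 :: q.val.2 ∧ P.E q.val.1 r.val.1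
  Ω := fun q => P.Ω q.val.1

/- ### The Kripke encoding of parity games and the formulas W_n -/

/- Propositional indices used for the encoding:
`bd = 0`, `pos = 1`, `pre₀ = 2`, `nxt₀ = 3`, `pre₁ = 4`, `nxt₁ = 5`,
`P_∃ = 6`, `P_∀ = 7`, `P_j = 8 + j`. -/

/-- Worlds of the Kripke model encoding a parity game: a world `pos v` for
each position `v`, and intermediate choice/confirmation worlds `mid u u'`
for the edges. -/
inductive EncW (Pos : Type) : Type where
  | pos : Pos → EncW Pos
  | mid : Pos → Pos → EncW Pos

/-- Choice steps (`R₀`) of the encoding. -/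
def encR0 (P : PGame) : EncW P.Pos → EncW P.Pos → Prop
  | EncW.pos v, EncW.mid u u' => v = u ∧ P.E u u'
  | _, _ => False

/-- Confirmation steps (`R₁`) of the encoding. -/
def encR1 (P : PGame) : EncW P.Pos → EncW P.Pos → Prop
  | EncW.mid u u', EncW.pos v => v = u' ∧ P.E u u'
  | _, _ => False

/-- Valuation of the encoding. -/
def encV (P : PGame) : ℕ → Set (EncW P.Pos) := fun n =>
  if n = 0 then Set.univ                                         -- bd
  else if n = 1 then {x | ∃ v, x = EncW.pos v}                   -- pos
  else if n = 2 then {x | ∃ v, x = EncW.pos v}                   -- pre₀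
  else if n = 3 then {x | ∃ u u', x = EncW.mid u u'}             -- nxt₀
  else if n = 4 then {x | ∃ u u', x = EncW.mid u u'}             -- pre₁
  else if n = 5 then {x | ∃ v, x = EncW.pos v}                   -- nxt₁
  else if n = 6 then {x | ∃ v, x = EncW.pos v ∧ P.ownE v}        -- P_∃
  else if n = 7 then {x | ∃ v, x = EncW.pos v ∧ ¬ P.ownE v}      -- P_∀
  else {x | ∃ v, x = EncW.pos v ∧ P.Ω v = n - 8}                 -- P_{n-8}

/-- The bimodal Kripke model `P^K` encoding the parity game `P`. -/
def encModel (P : PGame) : KModel (Fin 2) (EncW P.Pos) where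
  R := fun i => if i = 0 then encR0 P else encR1 P
  V := encV P

/-- `♦φ := νY. pre₀ ∧ bd ∧ ◇₀(nxt₀ ∧ pre₁ ∧ bd ∧ ◇₁(nxt₁ ∧ bd ∧
((Y ∧ ¬pos) ∨ (φ ∧ pos))))`. -/
def DiamW (Y : ℕ) (φ : MuForm (Fin 2)) : MuForm (Fin 2) :=
  .nu Y (.and (.prop 2) (.and (.prop 0)
    (.dia 0 (.and (.prop 3) (.and (.prop 4) (.and (.prop 0)
      (.dia 1 (.and (.prop 5) (.and (.prop 0)
        (.or (.and (.var Y) (.nprop 1)) (.and φ (.prop 1))))))))))))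

/-- `■φ := νY. (pre₀ ∧ bd → □₀(nxt₀ ∧ pre₁ ∧ bd → □₁(nxt₁ ∧ bd →
((Y ∧ ¬pos) ∧ (φ ∧ pos)))))`, implications written disjunctively. -/
def BoxW (Y : ℕ) (φ : MuForm (Fin 2)) : MuForm (Fin 2) :=
  .nu Y (.or (.or (.nprop 2) (.nprop 0))
    (.box 0 (.or (.or (.nprop 3) (.or (.nprop 4) (.nprop 0)))
      (.box 1 (.or (.or (.nprop 5) (.nprop 0))
        (.and (.and (.var Y) (.nprop 1)) (.and φ (.prop 1))))))))

/-- The `j`-th disjunct `(P_j ∧ P_∃ ∧ ♦X_j) ∨ (P_j ∧ P_∀ ∧ ■X_j)`. -/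
def WDisj (Y j : ℕ) : MuForm (Fin 2) :=
  .or (.and (.prop (8 + j)) (.and (.prop 6) (DiamW Y (.var j))))
      (.and (.prop (8 + j)) (.and (.prop 7) (BoxW Y (.var j))))

/-- The disjunction `⋁_{0 ≤ j ≤ n} [(P_j ∧ P_∃ ∧ ♦X_j) ∨ (P_j ∧ P_∀ ∧ ■X_j)]`. -/
def WBody (Y : ℕ) : ℕ → MuForm (Fin 2)
  | 0 => WDisj Y 0
  | j + 1 => .or (WBody Y (j)) (WDisj Y (j + 1))

/-- The alternating block of binders `ηX_n … νX_2 μX_1 νX_0`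
(`νX_j` for even `j`, `μX_j` for odd `j`). -/
def WBind : ℕ → MuForm (Fin 2) → MuForm (Fin 2)
  | 0, φ => .nu 0 φ
  | j + 1, φ =>
      if Even (j + 1) then .nu (j + 1) (WBind j φ) else .mu (j + 1) (WBind j φ)

/-- The winning region formula
`W_n := ηX_n … νX_2 μX_1 νX_0. ⋁_{0≤j≤n} [(P_j ∧ P_∃ ∧ ♦X_j) ∨ (P_j ∧ P_∀ ∧ ■X_j)]`,
where the fresh variable `Y` of `♦`/`■` is `n + 1`. -/
def Wfml (n : ℕ) : MuForm (Fin 2) := WBind n (WBody (n + 1) n)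

/- ### Pointed bimodal models, restriction, isomorphisms, the map f_φ -/

/-- A pointed bimodal Kripke model. -/
structure PModel : Type 1 where
  World : Type
  R0 : World → World → Prop
  R1 : World → World → Prop
  V : ℕ → Set World
  pt : World

/-- The underlying bimodal Kripke model. -/
def PModel.toK (M : PModel) : KModel (Fin 2) M.World :=
  ⟨fun i => if i = 0 then M.R0 else M.R1, M.V⟩

/-- The edges of the graph of a pointed bimodal model. -/
def PModel.edge (M : PModel) (x y : M.World) : Prop := M.R0 x y ∨ M.R1 x y

/-- The graph of the model has no loops. -/
def PModel.Acyclic (M : PModel) : Prop :=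
  ∀ x : M.World, ¬ Relation.TransGen M.edge x x

/-- Reachability in at most `k` steps. -/
def stepsLe (M : PModel) : ℕ → M.World → M.World → Prop
  | 0 => fun x y => x = y
  | k + 1 => fun x y => stepsLe M k x y ∨ ∃ u, stepsLe M k x u ∧ M.edge u y

/-- The worlds at distance less than `n` from the distinguished point. -/
def PModel.ball (M : PModel) (n : ℕ) : Set M.World :=
  {v | ∃ k, k + 1 ≤ n ∧ stepsLe M k M.pt v}

/-- `e` is an isomorphism between the restrictions `(M↾n, w)` and `(M'↾n, w')`,
i.e. an `n`-isomorphism. -/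
structure IsNIso (M M' : PModel) (n : ℕ)
    (e : {x // x ∈ M.ball n} ≃ {x // x ∈ M'.ball n}) : Prop where
  pt : ∀ hx : M.pt ∈ M.ball n, (e ⟨M.pt, hx⟩).val = M'.pt
  r0 : ∀ x y : {x // x ∈ M.ball n}, M.R0 x.val y.val ↔ M'.R0 (e x).val (e y).val
  r1 : ∀ x y : {x // x ∈ M.ball n}, M.R1 x.val y.val ↔ M'.R1 (e x).val (e y).val
  vals : ∀ (p : ℕ) (x : {x // x ∈ M.ball n}), x.val ∈ M.V p ↔ (e x).val ∈ M'.V p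

/-- The pointed models are `n`-isomorphic. -/
def NIsomorphic (M M' : PModel) (n : ℕ) : Prop := ∃ e, IsNIso M M' n e

/-- `e` is an isomorphism of pointed bimodal models. -/
structure IsIsoP (M M' : PModel) (e : M.World ≃ M'.World) : Prop where
  pt : e M.pt = M'.pt
  r0 : ∀ x y : M.World, M.R0 x y ↔ M'.R0 (e x) (e y)
  r1 : ∀ x y : M.World, M.R1 x y ↔ M'.R1 (e x) (e y)
  vals : ∀ (p : ℕ) (x : M.World), x ∈ M.V p ↔ e x ∈ M'.V p

/-- The pointed models are isomorphic. -/
def IsomorphicP (M M' : PModel) : Prop := ∃ e, IsIsoP M M' e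

/-- The map `f_φ` sending a pointed bimodal model `(M, w)` to the pointed
Kripke model `(𝒢^K(M, w ⊨ φ), ⟨φ, w⟩)` representing its evaluation game,
where `𝒢^K(M, w ⊨ φ) = (𝒢^P(M, w ⊨ φ))^K`. -/
noncomputable def fGame (φ : MuForm (Fin 2)) (M : PModel) : PModel where
  World := EncW (MuForm (Fin 2) × M.World)
  R0 := encR0 (evalPGame M.toK M.pt φ)
  R1 := encR1 (evalPGame M.toK M.pt φ)
  V := encV (evalPGame M.toK M.pt φ)
  pt := EncW.pos (φ, M.pt)

/- ### Modal logics, fusions of logics, GLP -/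

/-- Modal formulas (no fixed points) over a signature `I`, with full
implication and falsum. -/
inductive MForm (I : Type) : Type where
  | prop : ℕ → MForm I
  | fls : MForm I
  | imp : MForm I → MForm I → MForm I
  | box : I → MForm I → MForm I

namespace MForm

variable {I : Type}

def neg (a : MForm I) : MForm I := a.imp .fls

def conj (a b : MForm I) : MForm I := (a.imp b.neg).neg

def diam (i : I) (a : MForm I) : MForm I := (MForm.box i a.neg).neg

def iff (a b : MForm I) : MForm I := conj (a.imp b) (b.imp a)

/-- Kripke semantics for modal formulas. -/
def semM {W : Type} (R : I → W → W → Prop) (V : ℕ → Set W) : MForm I → Set W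
  | prop p => V p
  | fls => ∅
  | imp a b => {w | w ∈ semM R V a → w ∈ semM R V b}
  | box i a => {w | ∀ v, R i w v → v ∈ semM R V a}

/-- Uniform substitution of formulas for propositional symbols. -/
def substP (σ : ℕ → MForm I) : MForm I → MForm I
  | prop p => σ p
  | fls => fls
  | imp a b => imp (substP σ a) (substP σ b)
  | box i a => box i (substP σ a)

/-- The formula only uses modalities from `S`. -/
def UsesOnly (S : Set I) : MForm I → Prop
  | prop _ => True
  | fls => True
  | imp a b => UsesOnly S a ∧ UsesOnly S b
  | box i a => i ∈ S ∧ UsesOnly S a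

/-- The propositional symbol `x` occurs in the formula. -/
def PropOccurs (x : ℕ) : MForm I → Prop
  | prop p => p = x
  | fls => False
  | imp a b => PropOccurs x a ∨ PropOccurs x b
  | box _ a => PropOccurs x a

/-- Every occurrence of the propositional symbol `x` is within the scope of
some modality. -/
def Guarded (x : ℕ) : MForm I → Prop
  | prop p => p ≠ x
  | fls => True
  | imp a b => Guarded x a ∧ Guarded x b
  | box _ _ => True

end MForm

/-- Propositional tautologies: formulas true under every boolean valuation
treating propositional symbols and boxed formulas as atoms. -/
def IsTaut {I : Type} (φ : MForm I) : Prop :=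
  ∀ val : MForm I → Prop, ¬ val .fls →
    (∀ a b : MForm I, val (a.imp b) ↔ (val a → val b)) → val φ

/-- A modal formula is valid on a frame: it holds at every world under
every valuation. -/
def ValidOn {I : Type} (F : Frame I) (φ : MForm I) : Prop :=
  ∀ (V : ℕ → Set F.World) (w : F.World), w ∈ MForm.semM F.R V φ

/-- `L` is a normal modal logic in the signature `S`. -/
structure IsNormalIn {I : Type} (S : Set I) (L : Set (MForm I)) : Prop where
  inSig : ∀ φ ∈ L, MForm.UsesOnly S φ
  taut : ∀ φ : MForm I, MForm.UsesOnly S φ → IsTaut φ → φ ∈ L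
  axK : ∀ i ∈ S, ∀ a b : MForm I, MForm.UsesOnly S a → MForm.UsesOnly S b →
    ((MForm.box i (a.imp b)).imp ((MForm.box i a).imp (MForm.box i b))) ∈ L
  mp : ∀ a b : MForm I, a ∈ L → (a.imp b) ∈ L → b ∈ L
  nec : ∀ i ∈ S, ∀ a : MForm I, a ∈ L → MForm.box i a ∈ L
  subst : ∀ σ : ℕ → MForm I, (∀ p, MForm.UsesOnly S (σ p)) →
    ∀ a ∈ L, a.substP σ ∈ L

/-- The fusion of a family of modal logics: the smallest normal modal logic
in the combined signature containing each of them. -/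
def FusionLogic {I J : Type} (Ls : J → Set (MForm I)) : Set (MForm I) :=
  ⋂₀ {L : Set (MForm I) | IsNormalIn Set.univ L ∧ ∀ j, Ls j ⊆ L}

/-- Extension of a frame for the `j`-th component signature to the full
signature (the other relations are empty; validity of formulas in the
component signature is unaffected). -/
def extendFrame {I J : Type} (c : I → J) (j : J)
    (F : Frame {i : I // c i = j}) : Frame I :=
  ⟨F.World, fun i w v => ∃ h : c i = j, F.R ⟨i, h⟩ w v⟩

/-- The reduct of a frame for the full signature to the `j`-th component. -/
def Frame.reductTo {I J : Type} (c : I → J) (j : J) (F : Frame I) :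
    Frame {i : I // c i = j} :=
  ⟨F.World, fun i => F.R i.val⟩

/-- `L` is characterized by the class `Fs` of frames in the `j`-th component
signature: `L` consists exactly of the formulas of that signature valid on
every frame of `Fs`. -/
def CharacterizedBy {I J : Type} (c : I → J) (j : J) (L : Set (MForm I))
    (Fs : Set (Frame {i : I // c i = j})) : Prop :=
  L = {φ | MForm.UsesOnly {i | c i = j} φ ∧
        ∀ F ∈ Fs, ValidOn (extendFrame c j F) φ}

/-- The fusion of classes of frames in pairwise disjoint signatures. -/
def FusionFrames {I J : Type} (c : I → J)
    (Fs : ∀ j : J, Set (Frame {i : I // c i = j})) : Set (Frame I) :=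
  {F | ∀ j, F.reductTo c j ∈ Fs j}

/-- The finite model property for a logic in signature `S`. -/
def HasFMP {I : Type} (S : Set I) (L : Set (MForm I)) : Prop :=
  ∀ φ : MForm I, MForm.UsesOnly S φ → φ ∉ L →
    ∃ (W : Type) (_ : Finite W) (R : I → W → W → Prop) (V : ℕ → Set W),
      (∀ ψ ∈ L, ∀ w : W, w ∈ MForm.semM R V ψ) ∧ ∃ w : W, w ∉ MForm.semM R V φ

/-- The provability logic `GLP` (signature `ℕ`). -/
inductive GLPthm : MForm ℕ → Prop where
  | taut {φ : MForm ℕ} : IsTaut φ → GLPthm φ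
  | axK (n : ℕ) (a b : MForm ℕ) :
      GLPthm ((MForm.box n (a.imp b)).imp ((MForm.box n a).imp (MForm.box n b)))
  | axLob (n : ℕ) (a : MForm ℕ) :
      GLPthm ((MForm.box n ((MForm.box n a).imp a)).imp (MForm.box n a))
  | axMono {m n : ℕ} (h : m ≤ n) (a : MForm ℕ) :
      GLPthm ((MForm.box m a).imp (MForm.box n a))
  | axStab {m n : ℕ} (h : m ≤ n) (a : MForm ℕ) :
      GLPthm ((MForm.box m a).imp (MForm.box n (MForm.box m a)))
  | axStabD {m n : ℕ} (h : m ≤ n) (a : MForm ℕ) :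
      GLPthm ((MForm.diam m a).imp (MForm.box n (MForm.diam m a)))
  | mp {a b : MForm ℕ} : GLPthm (a.imp b) → GLPthm a → GLPthm b
  | nec (n : ℕ) {a : MForm ℕ} : GLPthm a → GLPthm (MForm.box n a)
  | subst (σ : ℕ → MForm ℕ) {a : MForm ℕ} : GLPthm a → GLPthm (a.substP σ)

/- ### Frame classes for the standard modal logics -/

def FK : Set (Frame Unit) := Set.univ
def FK4 : Set (Frame Unit) := {F | Transitive (F.R ())}
def FS4 : Set (Frame Unit) := {F | Reflexive (F.R ()) ∧ Transitive (F.R ())}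
def FKD45 : Set (Frame Unit) :=
  {F | (∀ w, ∃ v, F.R () w v) ∧ Transitive (F.R ()) ∧
    (∀ w v u, F.R () w v → F.R () w u → F.R () v u)}
def FS5 : Set (Frame Unit) := {F | Equivalence (F.R ())}
def FGL : Set (Frame Unit) :=
  {F | Transitive (F.R ()) ∧ ¬ ∃ f : ℕ → F.World, ∀ k, F.R () (f k) (f (k + 1))}

namespace AH

/-- Nested fixed points. -/
noncomputable def N {S : Type} (nu : ℕ → Prop) : ℕ → ((ℕ → Set S) → Set S) → (ℕ → Set S) → Set S
  | 0, F, e => F e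
  | k + 1, F, e => by
      classical
      exact if nu k then sSup {A : Set S | A ⊆ N nu k F (Function.update e k A)}
        else sInf {A : Set S | N nu k F (Function.update e k A) ⊆ A}

/-- monotone, and depending on the first `m` arguments only -/
def MB {S : Type} (m : ℕ) (F : (ℕ → Set S) → Set S) : Prop :=
  ∀ X Y : ℕ → Set S, (∀ j < m, X j ⊆ Y j) → F X ⊆ F Y

def MO {S : Type} (F : (ℕ → Set S) → Set S) : Prop :=
  ∀ X Y : ℕ → Set S, (∀ j, X j ⊆ Y j) → F X ⊆ F Y

theorem MB.mo {S : Type} {m : ℕ} {F : (ℕ → Set S) → Set S} (h : MB m F) : MO F :=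
  fun X Y hXY => h X Y fun j _ => hXY j

theorem N_succ_nu {S : Type} {nu : ℕ → Prop} {k : ℕ} (h : nu k) (F : (ℕ → Set S) → Set S)
    (e : ℕ → Set S) :
    N nu (k + 1) F e = sSup {A : Set S | A ⊆ N nu k F (Function.update e k A)} := by
  simp [N, h]

theorem N_succ_mu {S : Type} {nu : ℕ → Prop} {k : ℕ} (h : ¬ nu k) (F : (ℕ → Set S) → Set S)
    (e : ℕ → Set S) :
    N nu (k + 1) F e = sInf {A : Set S | N nu k F (Function.update e k A) ⊆ A} := by
  simp [N, h]

theorem lfp_eq {S : Type} (f : Set S → Set S) (hf : Monotone f) :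
    f (sInf {A | f A ⊆ A}) = sInf {A | f A ⊆ A} := OrderHom.map_lfp ⟨f, hf⟩

theorem gfp_eq {S : Type} (f : Set S → Set S) (hf : Monotone f) :
    f (sSup {A | A ⊆ f A}) = sSup {A | A ⊆ f A} := OrderHom.map_gfp ⟨f, hf⟩

theorem N_mono {S : Type} (nu : ℕ → Prop) (k : ℕ) :
    ∀ (F G : (ℕ → Set S) → Set S) (e e' : ℕ → Set S),
      (∀ X Y : ℕ → Set S, (∀ j, X j ⊆ Y j) → (∀ j, k ≤ j → X j = e j) →
        (∀ j, k ≤ j → Y j = e' j) → F X ⊆ G Y) →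
      (∀ j, e j ⊆ e' j) → N nu k F e ⊆ N nu k G e' := by
  induction k with
  | zero => 
    intro F G e e' h he
    exact h e e' he (fun _ _ => rfl) (fun _ _ => rfl)
  | succ k ih =>
    intro F G e e' h he
    have key : ∀ A : Set S, N nu k F (Function.update e k A) ⊆ N nu k G (Function.update e' k A) := by
      intro A
      apply ih
      · intro X Y hXY hX hY
        apply h X Y hXY
        · intro j hj
          rw [hX j (by omega), Function.update_of_ne (by omega)]
        · intro j hj
          rw [hY j (by omega), Function.update_of_ne (by omega)]
      · intro j
        by_cases hj : j = k
        · subst hj; simp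
        · simp [Function.update_of_ne hj, he j]
    by_cases hk : nu k
    · rw [N_succ_nu hk, N_succ_nu hk]
      apply sSup_le_sSup
      intro A hA
      exact Set.Subset.trans hA (key A)
    · rw [N_succ_mu hk, N_succ_mu hk]
      apply sInf_le_sInf
      intro A hA
      exact Set.Subset.trans (key A) hA

theorem N_mono_e {S : Type} (nu : ℕ → Prop) (k : ℕ) {F : (ℕ → Set S) → Set S} (hF : MO F)
    {e e' : ℕ → Set S} (h : ∀ j, e j ⊆ e' j) : N nu k F e ⊆ N nu k F e' :=
  N_mono nu k F F e e' (fun X Y hXY _ _ => hF X Y hXY) h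

theorem N_mono_upd {S : Type} (nu : ℕ → Prop) (k : ℕ) {F : (ℕ → Set S) → Set S} (hF : MO F)
    (e : ℕ → Set S) : Monotone fun A => N nu k F (Function.update e k A) := by
  intro A B hAB
  apply N_mono_e nu k hF
  intro j
  by_cases hj : j = k
  · subst hj; simpa using hAB
  · simp [Function.update_of_ne hj]

theorem N_fix {S : Type} (nu : ℕ → Prop) (k : ℕ) {F : (ℕ → Set S) → Set S} (hF : MO F)
    (e : ℕ → Set S) : N nu k F (Function.update e k (N nu (k + 1) F e)) = N nu (k + 1) F e := by
  by_cases hk : nu k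
  · rw [N_succ_nu hk]
    exact gfp_eq _ (N_mono_upd nu k hF e)
  · rw [N_succ_mu hk]
    exact lfp_eq _ (N_mono_upd nu k hF e)

theorem N_unfold {S : Type} (nu : ℕ → Prop) (k : ℕ) {F : (ℕ → Set S) → Set S} (hF : MO F) :
    ∀ e : ℕ → Set S, N nu k F e = F fun j => if j < k then N nu k F e else e j := by
  induction k with
  | zero => intro e; simp [N]
  | succ k ih =>
    intro e
    conv_lhs => rw [← N_fix nu k hF e, ih, N_fix nu k hF e]
    congr 1
    funext j
    by_cases h1 : j < k
    · simp [h1, Nat.lt_succ_of_lt h1]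
    · by_cases h2 : j = k
      · subst h2; simp
      · simp [h1, Function.update_of_ne h2, show ¬ j < k + 1 by omega]

theorem MB.unfold {S : Type} (nu : ℕ → Prop) {m : ℕ} {F : (ℕ → Set S) → Set S} (hF : MB m F)
    (e : ℕ → Set S) : N nu m F e = F fun _ => N nu m F e := by
  conv_lhs => rw [N_unfold nu m hF.mo e]
  apply Set.Subset.antisymm <;> apply hF <;> intro j hj <;> simp [hj]

theorem N_dual {S : Type} (nu : ℕ → Prop) (k : ℕ) (F : (ℕ → Set S) → Set S) :
    ∀ e : ℕ → Set S, N (fun j => ¬ nu j) k (fun X => (F fun j => (X j)ᶜ)ᶜ) (fun j => (e j)ᶜ)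
      = (N nu k F e)ᶜ := by
  induction k with
  | zero => intro e; simp [N]
  | succ k ih =>
    intro e
    have key : ∀ A : Set S, N (fun j => ¬ nu j) k (fun X => (F fun j => (X j)ᶜ)ᶜ)
        (Function.update (fun j => (e j)ᶜ) k A) = (N nu k F (Function.update e k Aᶜ))ᶜ := by
      intro A
      rw [← ih]
      congr 1
      funext j
      by_cases hj : j = k
      · subst hj; simp
      · simp [Function.update_of_ne hj]
    by_cases hk : nu k
    · rw [N_succ_nu hk, N_succ_mu (by simpa using hk)]
      ext x
      simp only [key, Set.sInf_eq_sInter, Set.sSup_eq_sUnion, Set.mem_sInter, Set.mem_compl_iff,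
        Set.mem_sUnion, Set.mem_setOf_eq, not_exists, not_and]
      constructor
      · intro h A hA hx
        have := h Aᶜ (by simpa using hA)
        exact this hx
      · intro h A hA
        by_contra hx
        exact h Aᶜ (Set.compl_subset_comm.1 hA) hx
    · rw [N_succ_mu hk, N_succ_nu (by simpa using hk)]
      ext x
      simp only [key, Set.sInf_eq_sInter, Set.sSup_eq_sUnion, Set.mem_sInter, Set.mem_compl_iff,
        Set.mem_sUnion, Set.mem_setOf_eq, not_forall]
      constructor
      · rintro ⟨A, hA, hx⟩
        exact ⟨Aᶜ, Set.subset_compl_comm.1 hA, fun h => h hx⟩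
      · rintro ⟨A, hA, hx⟩
        exact ⟨Aᶜ, by simpa using hA, hx⟩

/-- Winning structures. -/
structure WS {S : Type} (nu : ℕ → Prop) (m : ℕ) (P : Set S) (R : ℕ → S → S → Prop) : Prop where
  comp : ∀ i j, i < m → j < m → ∀ a b c, R i a b → R j b c → R (max i j) a c
  wf : ∀ j, j < m → ¬ nu j → ∀ Q : Set S, (∀ p ∈ P, (∀ p' ∈ P, R j p' p → p' ∈ Q) → p ∈ Q) → P ⊆ Q

theorem WS.mono {S : Type} {nu : ℕ → Prop} {k m : ℕ} (hk : k ≤ m) {P P' : Set S}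
    {R : ℕ → S → S → Prop} (h : WS nu m P R) (hP : P' ⊆ P) : WS nu k P' R where
  comp i j hi hj := h.comp i j (by omega) (by omega)
  wf j hj hn Q hQ := by
    have := h.wf j (by omega) hn {p | p ∈ P' → p ∈ Q} (by
      intro p _ ih hp'
      apply hQ p hp'
      intro p' hp'' hr
      exact ih p' (hP hp'') hr hp'')
    intro p hp
    exact this (hP hp) hp

theorem sound {S : Type} (nu : ℕ → Prop) (k : ℕ) {F : (ℕ → Set S) → Set S} (hF : MO F) :
    ∀ (e : ℕ → Set S) (P : Set S) (R : ℕ → S → S → Prop), WS nu k P R →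
      (∀ p ∈ P, p ∈ F fun j => {x | (j < k ∧ x ∈ P ∧ R j x p) ∨ (k ≤ j ∧ x ∈ e j)}) →
      P ⊆ N nu k F e := by
  induction k with
  | zero =>
    intro e P R _ h p hp
    simpa [N] using h p hp
  | succ k ih =>
    intro e P R hW h
    by_cases hk : nu k
    · rw [N_succ_nu hk]
      apply le_sSup (a := P)
      apply ih _ P R (hW.mono (by omega) le_rfl)
      intro p hp
      refine hF _ _ ?_ (h p hp)
      rintro j x (⟨h1, h2, h3⟩ | ⟨h1, h2⟩)
      · by_cases hj : j = k
        · subst hj; right; simpa using h2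
        · left; exact ⟨by omega, h2, h3⟩
      · right
        refine ⟨by omega, ?_⟩
        rwa [Function.update_of_ne (by omega)]
    · rw [N_succ_mu hk]
      apply le_sInf
      intro Z hZ
      apply hW.wf k (by omega) hk
      intro p hp hpZ
      apply hZ
      let P' : Set S := {x | x ∈ P ∧ (x = p ∨ ∃ j < k, R j x p)}
      have hP' : P' ⊆ P := fun x hx => hx.1
      refine ih (Function.update e k Z) P' R (hW.mono (by omega) hP') ?_ ⟨hp, Or.inl rfl⟩
      intro q hq
      refine hF _ _ ?_ (h q hq.1)
      rintro j x (⟨h1, h2, h3⟩ | ⟨h1, h2⟩)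
      · by_cases hj : j = k
        · subst hj; right
          refine ⟨le_rfl, ?_⟩
          simp only [Function.update_self]
          apply hpZ x h2
          rcases hq.2 with rfl | ⟨i, hi, hr⟩
          · exact h3
          · have := hW.comp j i h1 (by omega) _ _ _ h3 hr
            rwa [max_eq_left (by omega)] at this
        · left
          refine ⟨by omega, ⟨h2, ?_⟩, h3⟩
          right
          rcases hq.2 with rfl | ⟨i, hi, hr⟩
          · exact ⟨j, by omega, h3⟩
          · exact ⟨max j i, by omega, hW.comp j i h1 (by omega) _ _ _ h3 hr⟩
      · right
        refine ⟨by omega, ?_⟩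
        rwa [Function.update_of_ne (by omega)]

theorem lfp_rank {S : Type} (f : Set S → Set S) (hf : Monotone f) :
    ∃ rk : S → Ordinal.{0},
      (∀ p ∈ sInf {A | f A ⊆ A}, p ∈ f {x | x ∈ sInf {A | f A ⊆ A} ∧ rk x < rk p}) ∧
      ∀ a p, p ∈ f {x | x ∈ sInf {A | f A ⊆ A} ∧ rk x < a} → rk p ≤ a := by
  classical
  let g : Ordinal.{0} → Set S := OrdinalApprox.lfpApprox ⟨f, hf⟩ ⊥
  have hg : ∀ a, g a = ⋃ b, ⋃ (_ : b < a), f (g b) := by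
    intro a
    show OrdinalApprox.lfpApprox ⟨f, hf⟩ ⊥ a = _
    rw [OrdinalApprox.lfpApprox]
    simp [g]
  have hgm : ∀ a p, p ∈ g a ↔ ∃ b < a, p ∈ f (g b) := by
    intro a p
    rw [hg]; simp
  obtain ⟨a0, ha0⟩ := OrdinalApprox.lfp_mem_range_lfpApprox (f := ⟨f, hf⟩)
  have hl : sInf {A | f A ⊆ A} = g a0 := ha0.symm
  have hle : ∀ a, g a ⊆ sInf {A | f A ⊆ A} := by
    intro a
    induction a using WellFoundedLT.induction with
    | ind a ih =>
      intro p hp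
      obtain ⟨b, hb, hp⟩ := (hgm a p).1 hp
      rw [← lfp_eq f hf]
      exact hf (ih b hb) hp
  let rk : S → Ordinal.{0} := fun p => sInf {b | p ∈ f (g b)}
  have hrk : ∀ a p, p ∈ f (g a) → rk p ≤ a := fun a p h => csInf_le' h
  have hmem : ∀ p ∈ sInf {A | f A ⊆ A}, p ∈ f (g (rk p)) := by
    intro p hp
    rw [hl] at hp
    obtain ⟨b, _, hb⟩ := (hgm _ p).1 hp
    exact csInf_mem (s := {b | p ∈ f (g b)}) ⟨b, hb⟩
  refine ⟨rk, ?_, ?_⟩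
  · intro p hp
    refine hf ?_ (hmem p hp)
    intro x hx
    refine ⟨hle _ hx, ?_⟩
    obtain ⟨b, hb, hx⟩ := (hgm _ x).1 hx
    exact lt_of_le_of_lt (hrk b x hx) hb
  · intro a p hp
    apply hrk
    refine hf ?_ hp
    rintro x ⟨hx, hxa⟩
    exact (hgm _ _).2 ⟨rk x, hxa, hmem x hx⟩

theorem complete {S : Type} (nu : ℕ → Prop) (k : ℕ) {F : (ℕ → Set S) → Set S} (hF : MO F) :
    ∀ (e : ℕ → Set S), ∃ R : ℕ → S → S → Prop, WS nu k (N nu k F e) R ∧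
      (∀ p ∈ N nu k F e,
        p ∈ F fun j => {x | (j < k ∧ x ∈ N nu k F e ∧ R j x p) ∨ (k ≤ j ∧ x ∈ e j)}) := by
  induction k with
  | zero =>
    intro e
    refine ⟨fun _ _ _ => False, ⟨fun i j hi => by omega, fun i hi => by omega⟩, ?_⟩
    intro p hp
    simpa [N] using hp
  | succ k ih =>
    intro e
    by_cases hk : nu k
    · obtain ⟨R, hW, hR⟩ := ih (Function.update e k (N nu (k + 1) F e))
      rw [N_fix nu k hF] at hW hR
      refine ⟨fun j a b => j < k → R j a b, ⟨?_, ?_⟩, ?_⟩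
      · intro i j hi hj a b c h1 h2 h3
        exact hW.comp i j (by omega) (by omega) a b c (h1 (by omega)) (h2 (by omega))
      · intro j hj hn Q hQ
        have hjk : j ≠ k := by rintro rfl; exact hn hk
        apply hW.wf j (by omega) hn Q
        intro p hp h
        apply hQ p hp
        intro p' hp' hr
        exact h p' hp' (hr (by omega))
      · intro p hp
        refine hF _ _ ?_ (hR p hp)
        rintro j x (⟨h1, h2, h3⟩ | ⟨h1, h2⟩)
        · exact Or.inl ⟨by omega, h2, fun _ => h3⟩
        · by_cases hj : j = k
          · subst hj
            left
            refine ⟨by omega, by simpa using h2, fun h => by omega⟩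
          · right
            refine ⟨by omega, ?_⟩
            rwa [Function.update_of_ne hj] at h2
    · have hfix := N_fix nu k hF e
      obtain ⟨rk, h1, h2⟩ := lfp_rank _ (N_mono_upd nu k hF e)
      rw [← N_succ_mu hk] at h1 h2
      set P := N nu (k + 1) F e with hP
      choose R hW hR using fun a : Ordinal.{0} =>
        ih (Function.update e k {x | x ∈ P ∧ rk x < a})
      have hQP : ∀ a, N nu k F (Function.update e k {x | x ∈ P ∧ rk x < a}) ⊆ P := by
        intro a
        conv_rhs => rw [← hfix]
        exact N_mono_upd nu k hF e (fun x hx => hx.1)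
      refine ⟨fun j x p => rk x < rk p ∨ (j < k ∧ rk x = rk p ∧ R (rk p) j x p), ⟨?_, ?_⟩, ?_⟩
      · rintro i j hi hj a b c (h3 | ⟨h3, h4, h5⟩) (h6 | ⟨h6, h7, h8⟩)
        · exact Or.inl (h3.trans h6)
        · exact Or.inl (h7 ▸ h3)
        · exact Or.inl (h4 ▸ h6)
        · refine Or.inr ⟨by omega, h4.trans h7, ?_⟩
          rw [h7] at h5
          exact (hW _).comp i j h3 h6 a b c h5 h8
      · intro j hj hn Q hQ
        have : ∀ a, ∀ p ∈ P, rk p = a → p ∈ Q := by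
          intro a
          induction a using WellFoundedLT.induction with
          | ind a iha =>
            by_cases hjk : j < k
            · have := (hW a).wf j hjk hn {p | rk p = a → p ∈ Q} (by
                intro p hp hind hpa
                apply hQ p (hQP a hp)
                rintro p' hp' (h3 | ⟨h3, h4, h5⟩)
                · exact iha (rk p') (hpa ▸ h3) p' hp' rfl
                · rw [hpa] at h4 h5
                  refine hind p' ?_ h5 h4
                  rw [← h4]
                  exact h1 p' hp')
              intro p hp hpa
              refine this ?_ hpa
              rw [← hpa]
              exact h1 p hp
            · intro p hp hpa
              apply hQ p hp
              rintro p' hp' (h3 | ⟨h3, h4, h5⟩)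
              · exact iha (rk p') (hpa ▸ h3) p' hp' rfl
              · exact absurd h3 hjk
        intro p hp
        exact this _ p hp rfl
      · intro p hp
        refine hF _ _ ?_ (hR (rk p) p (h1 p hp))
        rintro j x (⟨h3, h4, h5⟩ | ⟨h3, h4⟩)
        · left
          refine ⟨by omega, hQP _ h4, ?_⟩
          rcases lt_or_eq_of_le (h2 _ _ h4) with h | h
          · exact Or.inl h
          · exact Or.inr ⟨h3, h, h5⟩
        · by_cases hj : j = k
          · subst hj
            left
            simp only [Function.update_self] at h4
            exact ⟨by omega, h4.1, Or.inl h4.2⟩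
          · right
            refine ⟨by omega, ?_⟩
            rwa [Function.update_of_ne hj] at h4

/-- Solution of the nested system. -/
noncomputable def Sol {S : Type} (nu : ℕ → Prop) (m : ℕ) (F : (ℕ → Set S) → Set S) : Set S :=
  N nu m F fun _ => ∅

theorem Sol_eq {S : Type} (nu : ℕ → Prop) {m : ℕ} {F : (ℕ → Set S) → Set S} (hF : MB m F)
    (e : ℕ → Set S) : N nu m F e = Sol nu m F := by
  apply Set.Subset.antisymm
  · obtain ⟨R, hW, hR⟩ := complete nu m hF.mo e
    refine sound nu m hF.mo _ _ R hW ?_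
    intro p hp
    refine hF _ _ ?_ (hR p hp)
    rintro j hj x (h | h)
    · exact Or.inl h
    · omega
  · exact N_mono_e nu m hF.mo (by simp)

theorem Sol_sound {S : Type} {nu : ℕ → Prop} {m : ℕ} {F : (ℕ → Set S) → Set S} (hF : MB m F)
    {P : Set S} {R : ℕ → S → S → Prop} (hW : WS nu m P R)
    (h : ∀ p ∈ P, p ∈ F fun j => {x | x ∈ P ∧ R j x p}) : P ⊆ Sol nu m F := by
  refine sound nu m hF.mo _ _ R hW ?_
  intro p hp
  refine hF _ _ ?_ (h p hp)
  intro j hj x hx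
  exact Or.inl ⟨hj, hx⟩

theorem Sol_complete {S : Type} (nu : ℕ → Prop) {m : ℕ} {F : (ℕ → Set S) → Set S} (hF : MB m F) :
    ∃ R : ℕ → S → S → Prop, WS nu m (Sol nu m F) R ∧
      ∀ p ∈ Sol nu m F, p ∈ F fun j => {x | x ∈ Sol nu m F ∧ R j x p} := by
  obtain ⟨R, hW, hR⟩ := complete nu m hF.mo fun _ => ∅
  refine ⟨R, hW, ?_⟩
  intro p hp
  refine hF _ _ ?_ (hR p hp)
  rintro j hj x (h | h)
  · exact h.2
  · omega

/-- dual operator -/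
def du {S : Type} (F : (ℕ → Set S) → Set S) : (ℕ → Set S) → Set S :=
  fun X => (F fun j => (X j)ᶜ)ᶜ

theorem MB.du {S : Type} {m : ℕ} {F : (ℕ → Set S) → Set S} (hF : MB m F) : MB m (du F) := by
  intro X Y h
  apply Set.compl_subset_compl.2
  apply hF
  intro j hj
  exact Set.compl_subset_compl.2 (h j hj)

theorem Sol_du {S : Type} (nu : ℕ → Prop) {m : ℕ} {F : (ℕ → Set S) → Set S} (hF : MB m F) :
    Sol (fun j => ¬ nu j) m (du F) = (Sol nu m F)ᶜ := by
  have h := N_dual nu m F (fun _ => ∅)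
  have h2 : (Sol nu m F)ᶜ = N (fun j => ¬ nu j) m (AH.du F) (fun _ => (∅ : Set S)ᶜ) := h.symm
  rw [h2]
  exact (Sol_eq _ hF.du _).symm

theorem Sol_unfold {S : Type} (nu : ℕ → Prop) {m : ℕ} {F : (ℕ → Set S) → Set S} (hF : MB m F) :
    Sol nu m F = F fun _ => Sol nu m F := hF.unfold nu _

theorem du_du {S : Type} (F : (ℕ → Set S) → Set S) : du (du F) = F := by
  funext X; simp [du]

/-- simulation lemma -/
theorem Sol_sim {S S' : Type} (nu : ℕ → Prop) {m : ℕ} {F : (ℕ → Set S) → Set S}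
    {F' : (ℕ → Set S') → Set S'} (hF : MB m F) (hF' : MB m F') (D : Set S') (π : S' → S)
    (h : ∀ (X' : ℕ → Set S') (X : ℕ → Set S), (∀ j < m, ∀ s ∈ D, π s ∈ X j → s ∈ X' j) →
      ∀ s ∈ D, π s ∈ F X → s ∈ F' X') :
    ∀ s ∈ D, π s ∈ Sol nu m F → s ∈ Sol nu m F' := by
  obtain ⟨R, hW, hR⟩ := Sol_complete nu hF
  intro s hs hp
  have key : {s | s ∈ D ∧ π s ∈ Sol nu m F} ⊆ Sol nu m F' := by
    refine Sol_sound hF' (R := fun j a b => R j (π a) (π b)) ⟨?_, ?_⟩ ?_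
    · intro i j hi hj a b c
      exact hW.comp i j hi hj _ _ _
    · intro j hj hn Q hQ
      have := hW.wf j hj hn {p | ∀ s ∈ D, π s = p → s ∈ Q} (by
        rintro p hp ih s hs rfl
        apply hQ s ⟨hs, hp⟩
        intro p' hp' hr
        exact ih _ hp'.2 hr p' hp'.1 rfl)
      rintro s ⟨hs, hp⟩
      exact this hp s hs rfl
    · rintro s ⟨hs, hp⟩
      refine h _ _ ?_ s hs (hR _ hp)
      intro j hj s hs h
      exact ⟨⟨hs, h.1⟩, h.2⟩
  exact key ⟨hs, hp⟩

theorem Sol_bisim {S S' : Type} (nu : ℕ → Prop) {m : ℕ} {F : (ℕ → Set S) → Set S}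
    {F' : (ℕ → Set S') → Set S'} (hF : MB m F) (hF' : MB m F') (D : Set S') (π : S' → S)
    (h : ∀ (X' : ℕ → Set S') (X : ℕ → Set S), (∀ j < m, ∀ s ∈ D, (s ∈ X' j ↔ π s ∈ X j)) →
      ∀ s ∈ D, (s ∈ F' X' ↔ π s ∈ F X)) :
    ∀ s ∈ D, (s ∈ Sol nu m F' ↔ π s ∈ Sol nu m F) := by
  have half : ∀ (nu : ℕ → Prop) {F : (ℕ → Set S) → Set S}
    {F' : (ℕ → Set S') → Set S'} (hF : MB m F) (hF' : MB m F')
    (h : ∀ (X' : ℕ → Set S') (X : ℕ → Set S), (∀ j < m, ∀ s ∈ D, (s ∈ X' j ↔ π s ∈ X j)) →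
      ∀ s ∈ D, (s ∈ F' X' ↔ π s ∈ F X)), 
      ∀ s ∈ D, π s ∈ Sol nu m F → s ∈ Sol nu m F' := by
    intro nu F F' hF hF' h
    apply Sol_sim nu hF hF' D π
    intro X' X hX s hs hp
    have h1 := (h (fun j => {s | s ∈ D ∧ π s ∈ X j}) X (by
      intro j hj s hs; simp [hs]) s hs).2 hp
    refine hF' _ _ ?_ h1
    rintro j hj s ⟨h2, h3⟩
    exact hX j hj s h2 h3
  intro s hs
  refine ⟨?_, half nu hF hF' h s hs⟩
  contrapose
  intro hn
  have := half (fun j => ¬ nu j) hF.du hF'.du (by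
    intro X' X hX s hs
    simp only [du, Set.mem_compl_iff]
    rw [h _ (fun j => (X j)ᶜ) _ s hs]
    intro j hj s hs
    simp [hX j hj s hs]) s hs
  rw [Sol_du nu hF, Sol_du nu hF'] at this
  exact this hn

/-- mixing two sets along `C` -/
def mix {S : Type} (C X Y : Set S) : Set S := {s | (s ∈ C ∧ s ∈ X) ∨ (s ∉ C ∧ s ∈ Y)}

theorem mix_compl {S : Type} (C X Y : Set S) : mix C Xᶜ Yᶜ = (mix C X Y)ᶜ := by
  ext s; simp only [mix, Set.mem_setOf_eq, Set.mem_compl_iff]; tauto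

theorem mix_mono {S : Type} (C : Set S) {X Y X' Y' : Set S} (h : X ⊆ X') (h' : Y ⊆ Y') :
    mix C X Y ⊆ mix C X' Y' := by
  rintro s (⟨h1, h2⟩ | ⟨h1, h2⟩)
  · exact Or.inl ⟨h1, h h2⟩
  · exact Or.inr ⟨h1, h' h2⟩

def F2 {S : Type} (C : Set S) (F : (ℕ → Set S) → Set S) (X : ℕ → Set S) :
    (ℕ → Set (S × ℕ)) → Set (S × ℕ) :=
  fun Y => {t | t.1 ∈ F fun i => mix C (X (max i t.2)) {s' | (s', max i t.2) ∈ Y i}}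

noncomputable def F1 {S : Type} (nu : ℕ → Prop) (m : ℕ) (C : Set S) (F : (ℕ → Set S) → Set S) :
    (ℕ → Set S) → Set S :=
  fun X => F fun j => mix C (X j) {s' | (s', j) ∈ Sol nu m (F2 C F X)}

theorem F2_MB {S : Type} {m : ℕ} {C : Set S} {F : (ℕ → Set S) → Set S} (hF : MB m F)
    (X : ℕ → Set S) : MB m (F2 C F X) := by
  intro Y Y' h t ht
  refine hF _ _ ?_ ht
  intro i hi
  exact mix_mono C le_rfl (fun s' hs' => h i hi hs')

theorem F1_MB {S : Type} (nu : ℕ → Prop) {m : ℕ} {C : Set S} {F : (ℕ → Set S) → Set S}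
    (hF : MB m F) : MB m (F1 nu m C F) := by
  intro X X' h
  apply hF
  intro j hj
  apply mix_mono C (h j hj)
  intro s' hs'
  refine Sol_sim nu (F2_MB hF X) (F2_MB hF X') {t | t.2 < m} id ?_ (s', j) hj hs'
  intro Y' Y hY t ht
  apply hF
  intro i hi
  apply mix_mono C (h _ (max_lt hi ht))
  intro s hs
  exact hY i hi (s, max i t.2) (max_lt hi ht) hs

theorem F1_du {S : Type} (nu : ℕ → Prop) {m : ℕ} {C : Set S} {F : (ℕ → Set S) → Set S}
    (hF : MB m F) : F1 (fun j => ¬ nu j) m C (du F) = du (F1 nu m C F) := by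
  funext X
  have h2 : F2 C (du F) X = du (F2 C F fun j => (X j)ᶜ) := by
    funext Y
    ext t
    simp only [F2, du, Set.mem_setOf_eq, Set.mem_compl_iff, ← mix_compl]
    rfl
  unfold F1
  rw [h2, Sol_du nu (F2_MB hF _)]
  have h3 : ∀ j, (mix C (X j)ᶜ {s' | (s', j) ∈ Sol nu m (F2 C F fun j => (X j)ᶜ)})ᶜ =
      mix C (X j) {s' | (s', j) ∈ (Sol nu m (F2 C F fun j => (X j)ᶜ))ᶜ} := by
    intro j
    rw [← mix_compl, compl_compl]
    rfl
  unfold du at *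
  simp only [← h3, compl_compl]

theorem collapse_half {S : Type} (nu : ℕ → Prop) {m : ℕ} (C : Set S) {F : (ℕ → Set S) → Set S}
    (hF : MB m F) : ∀ s ∈ C, s ∈ Sol nu m F → s ∈ Sol nu m (F1 nu m C F) := by
  obtain ⟨R, hW, hR⟩ := Sol_complete nu hF
  set P := Sol nu m F with hP
  have key : {s | s ∈ P ∧ s ∈ C} ⊆ Sol nu m (F1 nu m C F) := by
    refine Sol_sound (F1_MB nu hF) (R := R) (hW.mono le_rfl fun s hs => hs.1) ?_
    rintro p ⟨hp, hpC⟩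
    refine hF _ _ ?_ (hR p hp)
    rintro j hj s ⟨hs, hr⟩
    by_cases hsC : s ∈ C
    · exact Or.inl ⟨hsC, ⟨hs, hsC⟩, hr⟩
    refine Or.inr ⟨hsC, ?_⟩
    have k2 : {t : S × ℕ | t.2 < m ∧ t.1 ∈ P ∧ R t.2 t.1 p} ⊆
        Sol nu m (F2 C F fun j => {x | x ∈ {s | s ∈ P ∧ s ∈ C} ∧ R j x p}) := by
      refine Sol_sound (F2_MB hF _) (R := fun j a b => R j a.1 b.1) ⟨?_, ?_⟩ ?_
      · intro i j hi hj a b c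
        exact hW.comp i j hi hj _ _ _
      · intro j hj hn Q hQ
        have := hW.wf j hj hn {p' | ∀ t : S × ℕ, t.1 = p' → t.2 < m → t.1 ∈ P → R t.2 t.1 p → t ∈ Q} (by
          rintro p' hp' ih t rfl h1 h2 h3
          apply hQ t ⟨h1, h2, h3⟩
          rintro t' ⟨h4, h5, h6⟩ h7
          exact ih _ h5 h7 t' rfl h4 h5 h6)
        rintro t ⟨h1, h2, h3⟩
        exact this h2 t rfl h1 h2 h3
      · rintro t ⟨h1, h2, h3⟩
        refine hF _ _ ?_ (hR _ h2)
        rintro i hi s ⟨h4, h5⟩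
        have h6 := hW.comp i t.2 hi h1 _ _ _ h5 h3
        by_cases hsC : s ∈ C
        · exact Or.inl ⟨hsC, ⟨h4, hsC⟩, h6⟩
        · exact Or.inr ⟨hsC, ⟨max_lt hi h1, h4, h6⟩, h5⟩
    exact k2 ⟨hj, hs, hr⟩
  intro s hs hp
  exact key ⟨hp, hs⟩

theorem collapse {S : Type} (nu : ℕ → Prop) {m : ℕ} (C : Set S) {F : (ℕ → Set S) → Set S}
    (hF : MB m F) : ∀ s ∈ C, (s ∈ Sol nu m F ↔ s ∈ Sol nu m (F1 nu m C F)) := by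
  intro s hs
  refine ⟨collapse_half nu C hF s hs, ?_⟩
  contrapose
  intro hn
  have := collapse_half (fun j => ¬ nu j) C hF.du s hs
  rw [Sol_du nu hF, F1_du nu hF, Sol_du nu (F1_MB nu hF)] at this
  exact this hn

end AH

namespace AH

open MuForm

theorem sem_congr {Λ W : Type} (M : KModel Λ W) (a : MuForm Λ) : ∀ (e e' : ℕ → Set W),
    (∀ x ∈ freeVars a, e x = e' x) → sem M e a = sem M e' a := by
  induction a with
  | prop p => intros; rfl
  | nprop p => intros; rfl
  | var x => intro e e' h; exact h x rfl
  | and a b iha ihb =>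
    intro e e' h
    simp only [sem]
    rw [iha e e' fun x hx => h x (Or.inl hx), ihb e e' fun x hx => h x (Or.inr hx)]
  | or a b iha ihb =>
    intro e e' h
    simp only [sem]
    rw [iha e e' fun x hx => h x (Or.inl hx), ihb e e' fun x hx => h x (Or.inr hx)]
  | box i a iha => intro e e' h; simp only [sem]; rw [iha e e' h]
  | dia i a iha => intro e e' h; simp only [sem]; rw [iha e e' h]
  | mu x a iha =>
    intro e e' h
    have : ∀ A, sem M (Function.update e x A) a = sem M (Function.update e' x A) a := by
      intro A
      apply iha
      intro y hy
      by_cases hyx : y = x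
      · subst hyx; simp
      · simp [hyx, h y ⟨hy, hyx⟩]
    simp only [sem, this]
  | nu x a iha =>
    intro e e' h
    have : ∀ A, sem M (Function.update e x A) a = sem M (Function.update e' x A) a := by
      intro A
      apply iha
      intro y hy
      by_cases hyx : y = x
      · subst hyx; simp
      · simp [hyx, h y ⟨hy, hyx⟩]
    simp only [sem, this]

theorem subst_notfree {Λ : Type} (X : ℕ) (ψ a : MuForm Λ) (h : X ∉ freeVars a) :
    subst X ψ a = a := by
  induction a with
  | prop p => rfl
  | nprop p => rfl
  | var x =>
    simp only [freeVars, Set.mem_singleton_iff] at h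
    simp [subst, Ne.symm h]
  | and a b iha ihb =>
    simp only [freeVars, Set.mem_union, not_or] at h
    simp [subst, iha h.1, ihb h.2]
  | or a b iha ihb =>
    simp only [freeVars, Set.mem_union, not_or] at h
    simp [subst, iha h.1, ihb h.2]
  | box i a iha => simp [subst, iha h]
  | dia i a iha => simp [subst, iha h]
  | mu x a iha =>
    simp only [subst]
    split_ifs with hx
    · rfl
    · rw [iha fun h' => h ⟨h', fun h2 => hx h2.symm⟩]
  | nu x a iha =>
    simp only [subst]
    split_ifs with hx
    · rfl
    · rw [iha fun h' => h ⟨h', fun h2 => hx h2.symm⟩]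

theorem sem_subst {Λ W : Type} (M : KModel Λ W) (X : ℕ) (ψ a : MuForm Λ) :
    ∀ (e : ℕ → Set W), CaptureFree X ψ a →
    sem M e (subst X ψ a) = sem M (Function.update e X (sem M e ψ)) a := by
  induction a with
  | prop p => intros; rfl
  | nprop p => intros; rfl
  | var x =>
    intro e h
    by_cases hx : x = X
    · subst hx; simp [subst, sem]
    · simp [subst, sem, hx]
  | and a b iha ihb => intro e h; simp only [subst, sem]; rw [iha e h.1, ihb e h.2]
  | or a b iha ihb => intro e h; simp only [subst, sem]; rw [iha e h.1, ihb e h.2]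
  | box i a iha => intro e h; simp only [subst, sem]; rw [iha e h]
  | dia i a iha => intro e h; simp only [subst, sem]; rw [iha e h]
  | mu x a iha =>
    intro e h
    by_cases hx : x = X
    · subst hx; simp [subst, sem]
    have h := h.resolve_left hx
    by_cases hf : X ∈ freeVars a
    · have : ∀ A, sem M (Function.update e x A) (subst X ψ a) =
          sem M (Function.update (Function.update e X (sem M e ψ)) x A) a := by
        intro A
        rw [iha _ h.2, Function.update_comm (Ne.symm hx)]
        congr 1
        congr 1
        apply sem_congr
        intro y hy
        have : y ≠ x := fun h' => h.1 hf (h' ▸ hy)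
        simp [this]
      simp only [subst, hx, if_false, sem, this]
    · have : X ∉ freeVars (mu x a) := fun h' => hf h'.1
      rw [subst_notfree _ _ _ this]
      apply sem_congr
      intro y hy
      have : y ≠ X := by rintro rfl; exact this hy
      simp [this]
  | nu x a iha =>
    intro e h
    by_cases hx : x = X
    · subst hx; simp [subst, sem]
    have h := h.resolve_left hx
    by_cases hf : X ∈ freeVars a
    · have : ∀ A, sem M (Function.update e x A) (subst X ψ a) =
          sem M (Function.update (Function.update e X (sem M e ψ)) x A) a := by
        intro A
        rw [iha _ h.2, Function.update_comm (Ne.symm hx)]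
        congr 1
        congr 1
        apply sem_congr
        intro y hy
        have : y ≠ x := fun h' => h.1 hf (h' ▸ hy)
        simp [this]
      simp only [subst, hx, if_false, sem, this]
    · have : X ∉ freeVars (nu x a) := fun h' => hf h'.1
      rw [subst_notfree _ _ _ this]
      apply sem_congr
      intro y hy
      have : y ≠ X := by rintro rfl; exact this hy
      simp [this]

/-- Transition conditions of automata. -/
inductive ANode (Λ Q : Type) : Type where
  | lit : ℕ → ANode Λ Q
  | nlit : ℕ → ANode Λ Q
  | var : ℕ → ANode Λ Q
  | and : Q → Q → ANode Λ Q
  | or : Q → Q → ANode Λ Q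
  | box : Λ → Q → ANode Λ Q
  | dia : Λ → Q → ANode Λ Q

def ANode.map {Λ Q Q' : Type} (f : Q → Q') : ANode Λ Q → ANode Λ Q'
  | .lit p => .lit p
  | .nlit p => .nlit p
  | .var x => .var x
  | .and a b => .and (f a) (f b)
  | .or a b => .or (f a) (f b)
  | .box i a => .box i (f a)
  | .dia i a => .dia i (f a)

def holds {Λ Q W : Type} (M : KModel Λ W) (env : ℕ → Set W) (X : Set (Q × W)) (w : W) :
    ANode Λ Q → Prop
  | .lit p => w ∈ M.V p
  | .nlit p => w ∉ M.V p
  | .var x => w ∈ env x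
  | .and a b => (a, w) ∈ X ∧ (b, w) ∈ X
  | .or a b => (a, w) ∈ X ∨ (b, w) ∈ X
  | .box i a => ∀ v, M.R i w v → (a, v) ∈ X
  | .dia i a => ∃ v, M.R i w v ∧ (a, v) ∈ X

theorem holds_mono {Λ Q W : Type} (M : KModel Λ W) {env env' : ℕ → Set W} {X Y : Set (Q × W)}
    (he : ∀ x, env x ⊆ env' x)
    (h : X ⊆ Y) (w : W) (nd : ANode Λ Q) (hh : holds M env X w nd) : holds M env' Y w nd := by
  cases nd with
  | lit p => exact hh
  | nlit p => exact hh
  | var x => exact he x hh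
  | and a b => exact ⟨h hh.1, h hh.2⟩
  | or a b => exact hh.imp (fun t => h t) (fun t => h t)
  | box i a => exact fun v hv => h (hh v hv)
  | dia i a => obtain ⟨v, hv, h'⟩ := hh; exact ⟨v, hv, h h'⟩

theorem holds_map {Λ Q Q' W : Type} (M : KModel Λ W) (env : ℕ → Set W) (f : Q → Q')
    (X : Set (Q' × W)) (w : W) (nd : ANode Λ Q) :
    holds M env X w (nd.map f) ↔ holds M env {s | (f s.1, s.2) ∈ X} w nd := by
  cases nd <;> rfl

def step {Λ Q W : Type} (M : KModel Λ W) (env : ℕ → Set W) (δ : Q → ANode Λ Q) (Ω : Q → ℕ) :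
    (ℕ → Set (Q × W)) → Set (Q × W) :=
  fun X => {s | holds M env (X (Ω s.1)) s.2 (δ s.1)}

theorem step_MB {Λ Q W : Type} (M : KModel Λ W) (env : ℕ → Set W) (δ : Q → ANode Λ Q) {Ω : Q → ℕ}
    {m : ℕ} (h : ∀ q, Ω q < m) : MB m (step M env δ Ω) := by
  intro X Y hXY s hs
  exact holds_mono M (fun _ => le_rfl) (hXY _ (h s.1)) _ _ hs

def Rep {Λ : Type} (nu : ℕ → Prop) (m : ℕ) (ψ : MuForm Λ) : Prop :=
  ∃ (Q : Type) (_ : Finite Q) (q0 : Q) (δ : Q → ANode Λ Q) (Ω : Q → ℕ), (∀ q, Ω q < m) ∧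
    ∀ (W : Type) (M : KModel Λ W) (env : ℕ → Set W) (x : W),
      x ∈ sem M env ψ ↔ (q0, x) ∈ Sol nu m (step M env δ Ω)

theorem Rep_lit {Λ : Type} (nu : ℕ → Prop) {m : ℕ} (hm : 1 ≤ m) (ψ : MuForm Λ)
    (nd : ANode Λ Unit) (h : ∀ (W : Type) (M : KModel Λ W) (env : ℕ → Set W) (x : W) X,
      x ∈ sem M env ψ ↔ holds M env X x nd) : Rep nu m ψ := by
  refine ⟨Unit, inferInstance, (), fun _ => nd, fun _ => 0, fun _ => hm, ?_⟩
  intro W M env x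
  rw [Sol_unfold _ (step_MB M env _ fun _ => hm)]
  exact h _ _ _ _ _

theorem embed {Λ Q Q' W : Type} (nu : ℕ → Prop) {m : ℕ} (M : KModel Λ W) (env : ℕ → Set W)
    {δ : Q → ANode Λ Q} {Ω : Q → ℕ} {δ' : Q' → ANode Λ Q'} {Ω' : Q' → ℕ}
    (h : ∀ q, Ω q < m) (h' : ∀ q, Ω' q < m)
    (f : Q → Q') (g : Q' → Q) (hg : ∀ q, g (f q) = q) (hδ : ∀ q, δ' (f q) = (δ q).map f)
    (hΩ : ∀ q, Ω' (f q) = Ω q) (q : Q) (x : W) :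
    (f q, x) ∈ Sol nu m (step M env δ' Ω') ↔ (q, x) ∈ Sol nu m (step M env δ Ω) := by
  have := Sol_bisim nu (step_MB M env δ h) (step_MB M env δ' h') {s | ∃ q, s.1 = f q}
    (fun s => (g s.1, s.2)) (by
      rintro X' X hX ⟨s, w⟩ ⟨q, hq⟩
      simp only at hq
      subst hq
      simp only [step, hg, hδ, hΩ, Set.mem_setOf_eq]
      rw [holds_map]
      have : {s : Q × W | (f s.1, s.2) ∈ X' (Ω q)} = X (Ω q) := by
        ext ⟨q', w'⟩
        have := hX (Ω q) (h q) (f q', w') ⟨q', rfl⟩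
        simpa [hg] using this
      rw [this]) (f q, x) ⟨q, rfl⟩
  simpa [hg] using this

theorem Rep_join {Λ : Type} (nu : ℕ → Prop) {m : ℕ} (hm : 1 ≤ m) (a b ψ : MuForm Λ)
    (ha : Rep nu m a) (hb : Rep nu m b) (nd : ∀ Q, Q → Q → ANode Λ Q)
    (h : ∀ (Q W : Type) (M : KModel Λ W) (env : ℕ → Set W) (x : W) (X : Set (Q × W)) (qa qb : Q),
      (∀ y, y ∈ sem M env a ↔ (qa, y) ∈ X) → (∀ y, y ∈ sem M env b ↔ (qb, y) ∈ X) →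
      (x ∈ sem M env ψ ↔ holds M env X x (nd Q qa qb))) : Rep nu m ψ := by
  obtain ⟨QA, _, qa, δA, ΩA, hA, ha⟩ := ha
  obtain ⟨QB, _, qb, δB, ΩB, hB, hb⟩ := hb
  let Q := Option (QA ⊕ QB)
  let fa : QA → Q := fun q => some (Sum.inl q)
  let fb : QB → Q := fun q => some (Sum.inr q)
  let δ : Q → ANode Λ Q := fun q => match q with
    | none => nd Q (fa qa) (fb qb)
    | some (Sum.inl q) => (δA q).map fa
    | some (Sum.inr q) => (δB q).map fb
  let Ω : Q → ℕ := fun q => match q with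
    | none => 0
    | some (Sum.inl q) => ΩA q
    | some (Sum.inr q) => ΩB q
  have hΩ : ∀ q, Ω q < m := by
    rintro (_ | q | q)
    · exact hm
    · exact hA q
    · exact hB q
  refine ⟨Q, inferInstance, none, δ, Ω, hΩ, ?_⟩
  intro W M env x
  rw [Sol_unfold _ (step_MB M env _ hΩ)]
  apply h
  · intro y
    rw [ha]
    exact (embed nu M env hA hΩ fa (fun q => match q with
      | some (Sum.inl q) => q
      | _ => qa) (fun _ => rfl) (fun _ => rfl) (fun _ => rfl) qa y).symm
  · intro y
    rw [hb]
    exact (embed nu M env hB hΩ fb (fun q => match q with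
      | some (Sum.inr q) => q
      | _ => qb) (fun _ => rfl) (fun _ => rfl) (fun _ => rfl) qb y).symm

theorem Rep_and {Λ : Type} {nu : ℕ → Prop} {m : ℕ} (hm : 1 ≤ m) {a b : MuForm Λ}
    (ha : Rep nu m a) (hb : Rep nu m b) : Rep nu m (.and a b) := by
  refine Rep_join nu hm a b _ ha hb (fun Q x y => .and x y) ?_
  intro Q W M env x X qa qb h1 h2
  simp [sem, holds, h1, h2]

theorem Rep_or {Λ : Type} {nu : ℕ → Prop} {m : ℕ} (hm : 1 ≤ m) {a b : MuForm Λ}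
    (ha : Rep nu m a) (hb : Rep nu m b) : Rep nu m (.or a b) := by
  refine Rep_join nu hm a b _ ha hb (fun Q x y => .or x y) ?_
  intro Q W M env x X qa qb h1 h2
  simp [sem, holds, h1, h2]

theorem Rep_box {Λ : Type} {nu : ℕ → Prop} {m : ℕ} (hm : 1 ≤ m) {a : MuForm Λ} {i : Λ}
    (ha : Rep nu m a) : Rep nu m (.box i a) := by
  refine Rep_join nu hm a a _ ha ha (fun Q x y => .box i x) ?_
  intro Q W M env x X qa qb h1 h2
  simp [sem, holds, h1]

theorem Rep_dia {Λ : Type} {nu : ℕ → Prop} {m : ℕ} (hm : 1 ≤ m) {a : MuForm Λ} {i : Λ}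
    (ha : Rep nu m a) : Rep nu m (.dia i a) := by
  refine Rep_join nu hm a a _ ha ha (fun Q x y => .dia i x) ?_
  intro Q W M env x X qa qb h1 h2
  simp [sem, holds, h1]

theorem Rep_noFix {Λ : Type} {nu : ℕ → Prop} {m : ℕ} (hm : 1 ≤ m) {a : MuForm Λ}
    (h : noFix a) : Rep nu m a := by
  induction a with
  | prop p => exact Rep_lit nu hm _ (.lit p) (fun _ _ _ _ _ => Iff.rfl)
  | nprop p => exact Rep_lit nu hm _ (.nlit p) (fun _ _ _ _ _ => Iff.rfl)
  | var p => exact Rep_lit nu hm _ (.var p) (fun _ _ _ _ _ => Iff.rfl)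
  | and a b iha ihb => exact Rep_and hm (iha h.1) (ihb h.2)
  | or a b iha ihb => exact Rep_or hm (iha h.1) (ihb h.2)
  | box i a iha => exact Rep_box hm (iha h)
  | dia i a iha => exact Rep_dia hm (iha h)
  | mu x a iha => exact h.elim
  | nu x a iha => exact h.elim

theorem Sol_succ {S : Type} (nu : ℕ → Prop) {m : ℕ} {F : (ℕ → Set S) → Set S} (hF : MB m F) :
    Sol nu (m + 1) F = Sol nu m F := by
  unfold Sol
  by_cases h : nu m
  · rw [N_succ_nu h]
    simp only [Sol_eq nu hF]
    exact (isGreatest_Iic.isLUB.sSup_eq : sSup (Set.Iic (Sol nu m F)) = _)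
  · rw [N_succ_mu h]
    simp only [Sol_eq nu hF]
    exact (isLeast_Ici.isGLB.sInf_eq : sInf (Set.Ici (Sol nu m F)) = _)

theorem Rep_succ {Λ : Type} {nu : ℕ → Prop} {m : ℕ} {a : MuForm Λ}
    (h : Rep nu m a) : Rep nu (m + 1) a := by
  obtain ⟨Q, hQ, q0, δ, Ω, h1, h2⟩ := h
  refine ⟨Q, hQ, q0, δ, Ω, fun q => (h1 q).trans (Nat.lt_succ_self m), ?_⟩
  intro W M env x
  rw [Sol_succ nu (step_MB M env _ h1)]
  exact h2 _ _ _ _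

theorem mix_pos {S : Type} {C X Y : Set S} {s : S} (h : s ∈ C) : s ∈ mix C X Y ↔ s ∈ X := by
  simp [mix, h]

theorem mix_neg {S : Type} {C X Y : Set S} {s : S} (h : s ∉ C) : s ∈ mix C X Y ↔ s ∈ Y := by
  simp [mix, h]

open Classical in
theorem Rep_subst {Λ : Type} {nu : ℕ → Prop} {m : ℕ} (hm : 1 ≤ m) {a ψ : MuForm Λ} {X : ℕ}
    (ha : Rep nu m a) (hb : Rep nu m ψ) (hc : CaptureFree X ψ a) :
    Rep nu m (MuForm.subst X ψ a) := by
  obtain ⟨QA, _, qa, δA, ΩA, hA, ha⟩ := ha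
  obtain ⟨QB, _, qb, δB, ΩB, hB, hb⟩ := hb
  let Q := QA ⊕ QB
  let δ : Q → ANode Λ Q := fun q => match q with
    | Sum.inl q => if δA q = .var X then .or (Sum.inr qb) (Sum.inr qb) else (δA q).map Sum.inl
    | Sum.inr q => (δB q).map Sum.inr
  let Ω : Q → ℕ := fun q => match q with
    | (Sum.inl q) => ΩA q
    | (Sum.inr q) => ΩB q
  have hΩ : ∀ q, Ω q < m := by
    rintro (q | q)
    · exact hA q
    · exact hB q
  refine ⟨Q, inferInstance, Sum.inl qa, δ, Ω, hΩ, ?_⟩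
  intro W M env x
  rw [sem_subst _ _ _ _ _ hc, ha]
  have hF := step_MB M env δ hΩ
  rw [collapse nu {s | ∃ q, s.1 = Sum.inl q} hF (Sum.inl qa, x) ⟨qa, rfl⟩]
  have k1 : ∀ Z : ℕ → Set (Q × W), ∀ j y, ((Sum.inr qb, y), j) ∈
      Sol nu m (F2 {s | ∃ q, s.1 = Sum.inl q} (step M env δ Ω) Z) ↔ y ∈ sem M env ψ := by
    intro Z j y
    rw [hb]
    refine Sol_bisim nu (step_MB M env δB hB) (F2_MB hF Z) {s | ∃ q, s.1.1 = Sum.inr q}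
      (fun s => (match s.1.1 with
        | Sum.inl _ => qb
        | Sum.inr q => q, s.1.2)) ?_ ((Sum.inr qb, y), j) ⟨qb, rfl⟩
    rintro Y' Y hY ⟨⟨s, w⟩, i⟩ ⟨q, hq⟩
    simp only at hq
    subst hq
    show holds M env _ w ((δB q).map Sum.inr) ↔ holds M env _ w (δB q)
    rw [holds_map]
    have : {s : QB × W | (Sum.inr s.1, s.2) ∈ mix {s : Q × W | ∃ q, s.1 = Sum.inl q}
        (Z (max (ΩB q) i)) {s' | (s', max (ΩB q) i) ∈ Y' (ΩB q)}} = Y (ΩB q) := by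
      ext ⟨q', w'⟩
      have h3 := hY (ΩB q) (hB q) ((Sum.inr q', w'), max (ΩB q) i) ⟨q', rfl⟩
      simp only at h3
      rw [← h3]
      exact mix_neg (s := (Sum.inr q', w')) (by rintro ⟨_, h⟩; cases h)
    exact iff_of_eq (congrArg (fun T => holds M env T w (δB q)) this)
  symm
  refine Sol_bisim nu (step_MB M _ δA hA) (F1_MB nu hF) {s | ∃ q, s.1 = Sum.inl q}
      (fun s => (match s.1 with
        | Sum.inl q => q
        | Sum.inr _ => qa, s.2)) ?_ (Sum.inl qa, x) ⟨qa, rfl⟩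
  rintro Y' Y hY ⟨s, w⟩ ⟨q, hq⟩
  simp only at hq
  subst hq
  show holds M env _ w (if δA q = .var X then .or (Sum.inr qb) (Sum.inr qb) else (δA q).map Sum.inl)
    ↔ holds M _ _ w (δA q)
  split_ifs with hX
  · rw [hX]
    simp only [holds, Function.update_self]
    rw [or_self, ← k1 Y' (ΩA q)]
    exact mix_neg (s := (Sum.inr qb, w)) (by rintro ⟨_, h⟩; cases h)
  · rw [holds_map]
    have : {s : QA × W | (Sum.inl s.1, s.2) ∈ mix {s : Q × W | ∃ q, s.1 = Sum.inl q}
        (Y' (ΩA q)) {s' | (s', ΩA q) ∈ Sol nu m (F2 {s | ∃ q, s.1 = Sum.inl q} (step M env δ Ω) Y')}}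
          = Y (ΩA q) := by
      ext ⟨q', w'⟩
      have h3 := hY (ΩA q) (hA q) (Sum.inl q', w') ⟨q', rfl⟩
      simp only at h3
      rw [← h3]
      exact mix_pos (s := (Sum.inl q', w')) ⟨q', rfl⟩
    refine (iff_of_eq (congrArg (fun T => holds M env T w (δA q)) this)).trans ?_
    revert hX
    cases δA q with
    | var y =>
      intro hX
      have : y ≠ X := fun h => hX (h ▸ rfl)
      simp [holds, this]
    | _ => intro hX; rfl

end AH

namespace AH

open MuForm

open Classical in
theorem step_redirect {Λ Q W : Type} (nu : ℕ → Prop) (M : KModel Λ W) (env : ℕ → Set W)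
    (δ : Q → ANode Λ Q) (Ω : Q → ℕ) (k X : ℕ) (q0 : Q) (e : ℕ → Set (Q × W)) (Z : Set (Q × W)) :
    N nu k (step M env (fun q => if δ q = .var X then .or q0 q0 else δ q)
        (fun q => if δ q = .var X then k else Ω q)) (Function.update e k Z) =
      N nu k (step M (Function.update env X {x | (q0, x) ∈ Z}) δ Ω) (Function.update e k Z) := by
  have key : ∀ Y : ℕ → Set (Q × W), Y k = Z →
      step M env (fun q => if δ q = .var X then .or q0 q0 else δ q)
        (fun q => if δ q = .var X then k else Ω q) Y =
      step M (Function.update env X {x | (q0, x) ∈ Z}) δ Ω Y := by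
    intro Y hY
    ext ⟨q, w⟩
    show holds _ _ _ _ _ ↔ holds _ _ _ _ _
    simp only
    by_cases hX : δ q = .var X
    · rw [if_pos hX, if_pos hX, hY, hX]
      simp [holds]
    · rw [if_neg hX, if_neg hX]
      revert hX
      cases δ q with
      | var y =>
        intro hX
        have : y ≠ X := fun h => hX (h ▸ rfl)
        simp [holds, this]
      | _ => intro hX; rfl
  apply Set.Subset.antisymm
  · apply N_mono
    · intro A B hAB hA hB
      rw [key A (by simpa using hA k le_rfl)]
      intro s hs
      exact holds_mono M (fun _ => le_rfl) (hAB _) _ _ hs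
    · exact fun _ => le_rfl
  · apply N_mono
    · intro A B hAB hA hB
      rw [key B (by simpa using hB k le_rfl)]
      intro s hs
      exact holds_mono M (fun _ => le_rfl) (hAB _) _ _ hs
    · exact fun _ => le_rfl

theorem step_env_mono {Λ Q W : Type} (nu : ℕ → Prop) (M : KModel Λ W) {env env' : ℕ → Set W}
    (he : ∀ x, env x ⊆ env' x)
    (δ : Q → ANode Λ Q) (Ω : Q → ℕ) (k : ℕ) (e : ℕ → Set (Q × W)) :
    N nu k (step M env δ Ω) e ⊆ N nu k (step M env' δ Ω) e := by
  apply N_mono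
  · intro A B hAB hA hB s hs
    exact holds_mono M he (hAB _) _ _ hs
  · exact fun _ => le_rfl

theorem upd_mono {S : Type} (env : ℕ → Set S) (X : ℕ) {A B : Set S} (h : A ⊆ B) :
    ∀ x, Function.update env X A x ⊆ Function.update env X B x := by
  intro x
  by_cases hx : x = X
  · subst hx; simpa using h
  · simp [hx]

theorem MO_step {Λ Q W : Type} (M : KModel Λ W) (env : ℕ → Set W) (δ : Q → ANode Λ Q) (Ω : Q → ℕ) :
    MO (step M env δ Ω) := by
  intro X Y hXY s hs
  exact holds_mono M (fun _ => le_rfl) (hXY _) _ _ hs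

open Classical in
theorem Rep_mu {Λ : Type} {nu : ℕ → Prop} {k : ℕ} (hk : ¬ nu k) {a : MuForm Λ} {X : ℕ}
    (ha : Rep nu (k + 1) a) : Rep nu (k + 1) (MuForm.mu X a) := by
  obtain ⟨Q, hQ, q0, δ, Ω, h1, h2⟩ := ha
  refine ⟨Q, hQ, q0, fun q => if δ q = .var X then .or q0 q0 else δ q,
    fun q => if δ q = .var X then k else Ω q, ?_, ?_⟩
  · intro q
    simp only
    split_ifs
    · omega
    · exact h1 q
  intro W M env x
  set F' := step M env (fun q => if δ q = .var X then .or q0 q0 else δ q)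
    (fun q => if δ q = .var X then k else Ω q) with hF'
  have hS : ∀ S, sem M (Function.update env X S) a =
      {x | (q0, x) ∈ Sol nu (k + 1) (step M (Function.update env X S) δ Ω)} := by
    intro S; ext y; exact h2 _ _ _ _
  simp only [sem, hS]
  have hZ : Sol nu (k + 1) F' = sInf {A | N nu k F' (Function.update (fun _ => ∅) k A) ⊆ A} :=
    N_succ_mu hk _ _
  have hZfix := lfp_eq _ (N_mono_upd nu k (MO_step M env _ _ : MO F') (fun _ => ∅))
  rw [← hZ] at hZfix
  have hH : ∀ S, Sol nu (k + 1) (step M (Function.update env X S) δ Ω) =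
      sInf {A | N nu k (step M (Function.update env X S) δ Ω) (Function.update (fun _ => ∅) k A) ⊆ A} :=
    fun S => N_succ_mu hk _ _
  have hHfix : ∀ S, N nu k (step M (Function.update env X S) δ Ω) (Function.update (fun _ => ∅) k
      (Sol nu (k + 1) (step M (Function.update env X S) δ Ω))) =
        Sol nu (k + 1) (step M (Function.update env X S) δ Ω) := by
    intro S
    have := lfp_eq _ (N_mono_upd nu k (MO_step M (Function.update env X S) δ Ω) (fun _ => ∅))
    rwa [← hH S] at this
  constructor
  · intro hx
    refine hx {x | (q0, x) ∈ Sol nu (k + 1) F'} ?_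
    intro y hy
    refine (?_ : Sol nu (k + 1) _ ⊆ Sol nu (k + 1) F') hy
    rw [hH]
    apply sInf_le
    show N nu k _ _ ⊆ _
    rw [← step_redirect]
    exact hZfix.le
  · intro hx S hS
    refine hS ?_
    refine (?_ : Sol nu (k + 1) F' ⊆ Sol nu (k + 1) _) hx
    rw [hZ]
    apply sInf_le
    show N nu k F' _ ⊆ _
    rw [hF', step_redirect]
    refine (step_env_mono nu M (upd_mono env X hS) δ Ω k _).trans ?_
    exact (hHfix S).le

open Classical in
theorem Rep_nu {Λ : Type} {nu : ℕ → Prop} {k : ℕ} (hk : nu k) {a : MuForm Λ} {X : ℕ}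
    (ha : Rep nu (k + 1) a) : Rep nu (k + 1) (MuForm.nu X a) := by
  obtain ⟨Q, hQ, q0, δ, Ω, h1, h2⟩ := ha
  refine ⟨Q, hQ, q0, fun q => if δ q = .var X then .or q0 q0 else δ q,
    fun q => if δ q = .var X then k else Ω q, ?_, ?_⟩
  · intro q
    simp only
    split_ifs
    · omega
    · exact h1 q
  intro W M env x
  set F' := step M env (fun q => if δ q = .var X then .or q0 q0 else δ q)
    (fun q => if δ q = .var X then k else Ω q) with hF'
  have hS : ∀ S, sem M (Function.update env X S) a =
      {x | (q0, x) ∈ Sol nu (k + 1) (step M (Function.update env X S) δ Ω)} := by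
    intro S; ext y; exact h2 _ _ _ _
  simp only [sem, hS]
  have hZ : Sol nu (k + 1) F' = sSup {A | A ⊆ N nu k F' (Function.update (fun _ => ∅) k A)} :=
    N_succ_nu hk _ _
  have hZfix := gfp_eq _ (N_mono_upd nu k (MO_step M env _ _ : MO F') (fun _ => ∅))
  rw [← hZ] at hZfix
  have hH : ∀ S, Sol nu (k + 1) (step M (Function.update env X S) δ Ω) =
      sSup {A | A ⊆ N nu k (step M (Function.update env X S) δ Ω) (Function.update (fun _ => ∅) k A)} :=
    fun S => N_succ_nu hk _ _
  have hHfix : ∀ S, N nu k (step M (Function.update env X S) δ Ω) (Function.update (fun _ => ∅) k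
      (Sol nu (k + 1) (step M (Function.update env X S) δ Ω))) =
        Sol nu (k + 1) (step M (Function.update env X S) δ Ω) := by
    intro S
    have := gfp_eq _ (N_mono_upd nu k (MO_step M (Function.update env X S) δ Ω) (fun _ => ∅))
    rwa [← hH S] at this
  constructor
  · rintro ⟨S, hS, hx⟩
    have hx := hS hx
    refine (?_ : Sol nu (k + 1) _ ⊆ Sol nu (k + 1) F') hx
    rw [hZ]
    apply le_sSup
    show _ ⊆ N nu k F' _
    rw [hF', step_redirect]
    refine Set.Subset.trans ?_ (step_env_mono nu M (upd_mono env X hS) δ Ω k _)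
    exact (hHfix S).ge
  · intro hx
    refine ⟨{x | (q0, x) ∈ Sol nu (k + 1) F'}, ?_, hx⟩
    intro y hy
    refine (?_ : Sol nu (k + 1) F' ⊆ Sol nu (k + 1) _) hy
    rw [hH]
    apply le_sSup
    show _ ⊆ N nu k _ _
    rw [← step_redirect]
    exact hZfix.ge

theorem Rep_main {Λ : Type} {nu : ℕ → Prop} (hnu : ∀ k, nu (k + 1) ↔ ¬ nu k) {n : ℕ}
    {ψ : MuForm Λ} (h : SigmaMu n ψ) :
    (n = 0 → noFix ψ) ∧ ∀ k, n ≤ k + 1 → ¬ nu k → Rep nu (k + 1) ψ := by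
  refine SigmaMu.rec
    (motive_1 := fun n ψ _ => (n = 0 → noFix ψ) ∧ ∀ k, n ≤ k + 1 → ¬ nu k → Rep nu (k + 1) ψ)
    (motive_2 := fun n ψ _ => (n = 0 → noFix ψ) ∧ ∀ k, n ≤ k + 1 → nu k → Rep nu (k + 1) ψ)
    ?_ ?_ ?_ ?_ ?_ ?_ ?_ ?_ ?_ ?_ ?_ ?_ ?_ ?_ ?_ ?_ ?_ ?_ h
  · intro φ hφ
    exact ⟨fun _ => hφ, fun k _ _ => Rep_noFix (by omega) hφ⟩
  · intro n φ _ ih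
    exact ⟨by omega, fun k hk h => ih.2 k (by omega) h⟩
  · intro n φ _ ih
    refine ⟨by omega, fun k hk h => ?_⟩
    rcases n with _ | n
    · exact Rep_noFix (by omega) (ih.1 rfl)
    · obtain ⟨k, rfl⟩ : ∃ l, k = l + 1 := ⟨k - 1, by omega⟩
      exact Rep_succ (ih.2 k (by omega) (by have := hnu k; tauto))
  · intro n a b _ _ iha ihb
    exact ⟨by omega, fun k hk h => Rep_and (by omega) (iha.2 k hk h) (ihb.2 k hk h)⟩
  · intro n a b _ _ iha ihb
    exact ⟨by omega, fun k hk h => Rep_or (by omega) (iha.2 k hk h) (ihb.2 k hk h)⟩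
  · intro n i a _ iha
    exact ⟨by omega, fun k hk h => Rep_box (by omega) (iha.2 k hk h)⟩
  · intro n i a _ iha
    exact ⟨by omega, fun k hk h => Rep_dia (by omega) (iha.2 k hk h)⟩
  · intro n X a _ iha
    exact ⟨by omega, fun k hk h => Rep_mu h (iha.2 k hk h)⟩
  · intro n X a ψ _ _ hc iha ihb
    exact ⟨by omega, fun k hk h => Rep_subst (by omega) (iha.2 k hk h) (ihb.2 k hk h) hc⟩
  · intro φ hφ
    exact ⟨fun _ => hφ, fun k _ _ => Rep_noFix (by omega) hφ⟩
  · intro n φ _ ih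
    refine ⟨by omega, fun k hk h => ?_⟩
    rcases n with _ | n
    · exact Rep_noFix (by omega) (ih.1 rfl)
    · obtain ⟨k, rfl⟩ : ∃ l, k = l + 1 := ⟨k - 1, by omega⟩
      exact Rep_succ (ih.2 k (by omega) ((hnu k).1 h))
  · intro n φ _ ih
    exact ⟨by omega, fun k hk h => ih.2 k (by omega) h⟩
  · intro n a b _ _ iha ihb
    exact ⟨by omega, fun k hk h => Rep_and (by omega) (iha.2 k hk h) (ihb.2 k hk h)⟩
  · intro n a b _ _ iha ihb
    exact ⟨by omega, fun k hk h => Rep_or (by omega) (iha.2 k hk h) (ihb.2 k hk h)⟩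
  · intro n i a _ iha
    exact ⟨by omega, fun k hk h => Rep_box (by omega) (iha.2 k hk h)⟩
  · intro n i a _ iha
    exact ⟨by omega, fun k hk h => Rep_dia (by omega) (iha.2 k hk h)⟩
  · intro n X a _ iha
    exact ⟨by omega, fun k hk h => Rep_nu h (iha.2 k hk h)⟩
  · intro n X a ψ _ _ hc iha ihb
    exact ⟨by omega, fun k hk h => Rep_subst (by omega) (iha.2 k hk h) (ihb.2 k hk h) hc⟩

theorem Rep_main_pi {Λ : Type} {nu : ℕ → Prop} (hnu : ∀ k, nu (k + 1) ↔ ¬ nu k) {n : ℕ}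
    {ψ : MuForm Λ} (h : PiMu n ψ) :
    (n = 0 → noFix ψ) ∧ ∀ k, n ≤ k + 1 → nu k → Rep nu (k + 1) ψ := by
  refine PiMu.rec
    (motive_1 := fun n ψ _ => (n = 0 → noFix ψ) ∧ ∀ k, n ≤ k + 1 → ¬ nu k → Rep nu (k + 1) ψ)
    (motive_2 := fun n ψ _ => (n = 0 → noFix ψ) ∧ ∀ k, n ≤ k + 1 → nu k → Rep nu (k + 1) ψ)
    ?_ ?_ ?_ ?_ ?_ ?_ ?_ ?_ ?_ ?_ ?_ ?_ ?_ ?_ ?_ ?_ ?_ ?_ h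
  · intro φ hφ
    exact ⟨fun _ => hφ, fun k _ _ => Rep_noFix (by omega) hφ⟩
  · intro n φ _ ih
    exact ⟨by omega, fun k hk h => ih.2 k (by omega) h⟩
  · intro n φ _ ih
    refine ⟨by omega, fun k hk h => ?_⟩
    rcases n with _ | n
    · exact Rep_noFix (by omega) (ih.1 rfl)
    · obtain ⟨k, rfl⟩ : ∃ l, k = l + 1 := ⟨k - 1, by omega⟩
      exact Rep_succ (ih.2 k (by omega) (by have := hnu k; tauto))
  · intro n a b _ _ iha ihb
    exact ⟨by omega, fun k hk h => Rep_and (by omega) (iha.2 k hk h) (ihb.2 k hk h)⟩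
  · intro n a b _ _ iha ihb
    exact ⟨by omega, fun k hk h => Rep_or (by omega) (iha.2 k hk h) (ihb.2 k hk h)⟩
  · intro n i a _ iha
    exact ⟨by omega, fun k hk h => Rep_box (by omega) (iha.2 k hk h)⟩
  · intro n i a _ iha
    exact ⟨by omega, fun k hk h => Rep_dia (by omega) (iha.2 k hk h)⟩
  · intro n X a _ iha
    exact ⟨by omega, fun k hk h => Rep_mu h (iha.2 k hk h)⟩
  · intro n X a ψ _ _ hc iha ihb
    exact ⟨by omega, fun k hk h => Rep_subst (by omega) (iha.2 k hk h) (ihb.2 k hk h) hc⟩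
  · intro φ hφ
    exact ⟨fun _ => hφ, fun k _ _ => Rep_noFix (by omega) hφ⟩
  · intro n φ _ ih
    refine ⟨by omega, fun k hk h => ?_⟩
    rcases n with _ | n
    · exact Rep_noFix (by omega) (ih.1 rfl)
    · obtain ⟨k, rfl⟩ : ∃ l, k = l + 1 := ⟨k - 1, by omega⟩
      exact Rep_succ (ih.2 k (by omega) ((hnu k).1 h))
  · intro n φ _ ih
    exact ⟨by omega, fun k hk h => ih.2 k (by omega) h⟩
  · intro n a b _ _ iha ihb
    exact ⟨by omega, fun k hk h => Rep_and (by omega) (iha.2 k hk h) (ihb.2 k hk h)⟩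
  · intro n a b _ _ iha ihb
    exact ⟨by omega, fun k hk h => Rep_or (by omega) (iha.2 k hk h) (ihb.2 k hk h)⟩
  · intro n i a _ iha
    exact ⟨by omega, fun k hk h => Rep_box (by omega) (iha.2 k hk h)⟩
  · intro n i a _ iha
    exact ⟨by omega, fun k hk h => Rep_dia (by omega) (iha.2 k hk h)⟩
  · intro n X a _ iha
    exact ⟨by omega, fun k hk h => Rep_nu h (iha.2 k hk h)⟩
  · intro n X a ψ _ _ hc iha ihb
    exact ⟨by omega, fun k hk h => Rep_subst (by omega) (iha.2 k hk h) (ihb.2 k hk h) hc⟩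

/-- every formula of level `n` is represented with `n + 1` priorities -/
theorem Rep_all {Λ : Type} {nu : ℕ → Prop} (hnu : ∀ k, nu (k + 1) ↔ ¬ nu k) {n : ℕ}
    {ψ : MuForm Λ} (h : SigmaMu n ψ ∨ PiMu n ψ) : Rep nu (n + 1) ψ := by
  by_cases hk : nu (n + 1)
  · rcases h with h | h
    · exact (Rep_main hnu (SigmaMu.upS h)).2 n (by omega) ((hnu n).1 hk)
    · exact (Rep_main hnu (SigmaMu.upP h)).2 n (by omega) ((hnu n).1 hk)
  · have hk' : nu n := by have := hnu n; tauto
    rcases h with h | h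
    · exact (Rep_main_pi hnu (PiMu.upS h)).2 n (by omega) hk'
    · exact (Rep_main_pi hnu (PiMu.upP h)).2 n (by omega) hk'

def ANode.dual {Λ Q : Type} : ANode Λ Q → ANode Λ Q
  | .lit p => .nlit p
  | .nlit p => .lit p
  | .var x => .var x
  | .and a b => .or a b
  | .or a b => .and a b
  | .box i a => .dia i a
  | .dia i a => .box i a

theorem holds_dual {Λ Q W : Type} (M : KModel Λ W) (env : ℕ → Set W) (X : Set (Q × W)) (w : W)
    (nd : ANode Λ Q) : holds M (fun x => (env x)ᶜ) Xᶜ w nd.dual ↔ ¬ holds M env X w nd := by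
  cases nd <;> simp [holds, ANode.dual] <;> tauto

theorem coRep {Λ : Type} {nu : ℕ → Prop} (hnu : ∀ k, nu (k + 1) ↔ ¬ nu k) {n : ℕ}
    {ψ : MuForm Λ} (h : SigmaMu n ψ ∨ PiMu n ψ) :
    ∃ (Q : Type) (_ : Finite Q) (q0 : Q) (δ : Q → ANode Λ Q) (Ω : Q → ℕ), (∀ q, Ω q < n + 1) ∧
    ∀ (W : Type) (M : KModel Λ W) (x : W),
      x ∉ sem M (fun _ => ∅) ψ ↔ (q0, x) ∈ Sol nu (n + 1) (step M (fun _ => Set.univ) δ Ω) := by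
  have hnu' : ∀ k, (fun k => ¬ nu k) (k + 1) ↔ ¬ (fun k => ¬ nu k) k := by
    intro k; have := hnu k; simp only; tauto
  obtain ⟨Q, hQ, q0, δ, Ω, h1, h2⟩ := Rep_all (nu := fun k => ¬ nu k) hnu' h
  refine ⟨Q, hQ, q0, fun q => (δ q).dual, Ω, h1, ?_⟩
  intro W M x
  rw [h2, ← Set.mem_compl_iff, ← Sol_du _ (step_MB M _ δ h1)]
  have e1 : du (step M (fun _ => ∅) δ Ω) =
      step M (fun _ => Set.univ) (fun q => (δ q).dual) Ω := by
    funext X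
    ext ⟨q, w⟩
    have := holds_dual M (fun _ => ∅) (X (Ω q))ᶜ w (δ q)
    simp only [compl_compl, Set.compl_empty] at this
    exact this.symm
  rw [e1]
  simp only [not_not]

end AH

namespace AH

open MuForm

def diamF (a : MuForm (Fin 2)) : MuForm (Fin 2) := .dia 0 (.and (.prop 0) (.dia 1 (.and (.prop 1) a)))
def boxF (a : MuForm (Fin 2)) : MuForm (Fin 2) := .box 0 (.or (.nprop 0) (.box 1 (.or (.nprop 1) a)))
def disjF (j : ℕ) : MuForm (Fin 2) :=
  .and (.prop (5 + j)) (.or (.and (.prop 3) (diamF (.var j))) (.and (.prop 4) (boxF (.var j))))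
def bodyF : ℕ → MuForm (Fin 2)
  | 0 => .prop 2
  | j + 1 => .or (bodyF j) (disjF j)
def WB : ℕ → MuForm (Fin 2) → MuForm (Fin 2)
  | 0, φ => φ
  | k + 1, φ => if Even k then .nu k (WB k φ) else .mu k (WB k φ)

theorem noFix_bodyF (j : ℕ) : noFix (bodyF j) := by
  induction j with
  | zero => trivial
  | succ j ih => exact ⟨ih, by simp [disjF, diamF, boxF, noFix]⟩

theorem WB_class (φ : MuForm (Fin 2)) (h : noFix φ) (k : ℕ) :
    (Even k → SigmaMu k (WB k φ)) ∧ (¬ Even k → PiMu k (WB k φ)) := by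
  induction k with
  | zero => exact ⟨fun _ => .base h, fun h => absurd Even.zero h⟩
  | succ k ih =>
    by_cases hk : Even k
    · refine ⟨fun h => absurd hk (Nat.even_add_one.1 h), fun _ => ?_⟩
      simp only [WB, hk, if_true]
      exact .nuI (.upS (ih.1 hk))
    · refine ⟨fun _ => ?_, fun h => absurd (Nat.even_add_one.2 hk) h⟩
      simp only [WB, hk, if_false]
      exact .muI (.upP (ih.2 hk))

theorem sem_WB {W : Type} (M : KModel (Fin 2) W) (φ : MuForm (Fin 2)) (k : ℕ) :
    ∀ e, sem M e (WB k φ) = N Even k (fun v => sem M v φ) e := by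
  induction k with
  | zero => intro e; rfl
  | succ k ih =>
    intro e
    by_cases hk : Even k
    · rw [N_succ_nu hk]
      simp only [WB, hk, if_true, sem, ih]
    · rw [N_succ_mu hk]
      simp only [WB, hk, if_false, sem, ih]

theorem mem_bodyF {W : Type} (M : KModel (Fin 2) W) (v : ℕ → Set W) (m : ℕ) (w : W) :
    w ∈ sem M v (bodyF m) ↔ w ∈ M.V 2 ∨ ∃ j < m, w ∈ M.V (5 + j) ∧
      ((w ∈ M.V 3 ∧ ∃ x, M.R 0 w x ∧ x ∈ M.V 0 ∧ ∃ y, M.R 1 x y ∧ y ∈ M.V 1 ∧ y ∈ v j) ∨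
       (w ∈ M.V 4 ∧ ∀ x, M.R 0 w x → x ∈ M.V 0 → ∀ y, M.R 1 x y → y ∈ M.V 1 → y ∈ v j)) := by
  induction m with
  | zero => simp [bodyF, sem]
  | succ m ih =>
    show w ∈ sem M v (bodyF m) ∨ w ∈ sem M v (disjF m) ↔ _
    rw [ih, or_assoc]
    apply or_congr Iff.rfl
    simp only [disjF, diamF, boxF, sem, Nat.lt_succ_iff_lt_or_eq, or_and_right, exists_or,
      exists_eq_left]
    apply or_congr Iff.rfl
    simp only [Set.mem_inter_iff, Set.mem_union, Set.mem_setOf_eq, Set.mem_compl_iff,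
      ← imp_iff_not_or]

theorem body_MB {W : Type} (M : KModel (Fin 2) W) (m : ℕ) :
    MB m (fun v => sem M v (bodyF m)) := by
  intro X Y h w hw
  rw [mem_bodyF] at hw ⊢
  refine hw.imp_right ?_
  rintro ⟨j, hj, hp, h3⟩
  refine ⟨j, hj, hp, h3.imp ?_ ?_⟩
  · rintro ⟨h4, x, hx, hx0, y, hy, hy1, h5⟩
    exact ⟨h4, x, hx, hx0, y, hy, hy1, h j hj h5⟩
  · rintro ⟨h4, h5⟩
    exact ⟨h4, fun x hx hx0 y hy hy1 => h j hj (h5 x hx hx0 y hy hy1)⟩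

/-- worlds -/
abbrev Wd (Reg : Type) : Type := ℕ ⊕ (ℕ × Reg)

def c0 {Reg : Type} : Wd Reg → ℕ
  | Sum.inl n => n
  | Sum.inr p => p.1

def c1 {Reg : Type} : Wd Reg → ℕ
  | Sum.inl n => n / 2
  | Sum.inr p => p.1

theorem disjUnion_const {ι : Type} (F : Frame Unit) (x y : (Frame.disjUnion (fun _ : ι => F)).World) :
    (Frame.disjUnion (fun _ : ι => F)).R () x y ↔ x.1 = y.1 ∧ F.R () x.2 y.2 := by
  simp [Frame.disjUnion]

open Cardinal in
theorem beta_exists (A B K : Type) [Infinite K] (a0 : A) (b1 : B)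
    (hA : #A ≤ #K) (hB : #B ≤ #K) :
    Nonempty ({p : Option K × A // p ≠ (none, a0)} ≃
      {p : (Bool ⊕ K) × B // ∀ i, p ≠ (Sum.inl i, b1)}) := by
  have hK : ℵ₀ ≤ #K := aleph0_le_mk K
  have nA : Nonempty A := ⟨a0⟩
  have nB : Nonempty B := ⟨b1⟩
  have h1 : #(Option K × A) = #K := by
    rw [mk_prod, lift_id, lift_id, mk_option, add_one_eq hK, mul_eq_left hK hA]
    exact mk_ne_zero A
  have h2 : #((Bool ⊕ K) × B) = #K := by
    rw [mk_prod, lift_id, lift_id, mk_sum, lift_id, lift_id, add_eq_right hK, mul_eq_left hK hB]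
    · exact mk_ne_zero B
    · exact (mk_le_aleph0).trans hK
  have i1 : Infinite (Option K × A) := by rw [infinite_iff, h1]; exact hK
  have i2 : Infinite ((Bool ⊕ K) × B) := by rw [infinite_iff, h2]; exact hK
  have e1 : #(({(none, a0)} : Set (Option K × A))ᶜ : Set _) = #(Option K × A) :=
    mk_compl_of_infinite _ (by
      rw [h1]; exact (lt_aleph0_of_finite _).trans_le hK)
  have e2 : #((Set.range (fun i : Bool => ((Sum.inl i, b1) : (Bool ⊕ K) × B)))ᶜ : Set _) =
      #((Bool ⊕ K) × B) :=
    mk_compl_of_infinite _ (by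
      rw [h2]; exact (lt_aleph0_of_finite _).trans_le hK)
  obtain ⟨e⟩ := Cardinal.eq.1 ((e1.trans h1).trans (e2.trans h2).symm)
  refine ⟨(Equiv.subtypeEquivRight ?_).trans (e.trans (Equiv.subtypeEquivRight ?_))⟩
  · intro x; simp
  · intro x; simp

theorem fix_two {A B : Type} (e : A ≃ B) (a : Bool → A) (b : Bool → B)
    (ha : a false ≠ a true) (hb : b false ≠ b true) : ∃ e : A ≃ B, ∀ i, e (a i) = b i := by
  classical
  let e1 := e.trans (Equiv.swap (e (a false)) (b false))
  have h1 : e1 (a false) = b false := by simp [e1]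
  let e2 := e1.trans (Equiv.swap (e1 (a true)) (b true))
  refine ⟨e2, ?_⟩
  rintro (_ | _)
  · show Equiv.swap (e1 (a true)) (b true) (e1 (a false)) = _
    rw [Equiv.swap_apply_of_ne_of_ne, h1]
    · exact fun h => ha (e1.injective h)
    · rw [h1]; exact hb
  · simp [e2]

theorem iso_of_bij {F G : Frame Unit} (f : G.World → F.World) (hf : Function.Bijective f)
    (h : ∀ x y, G.R () x y ↔ F.R () (f x) (f y)) : FrameIso F G := by
  refine ⟨(Equiv.ofBijective f hf).symm, ?_⟩
  intro i w v
  rw [h]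
  have k : ∀ w, f ((Equiv.ofBijective f hf).symm w) = w :=
    fun w => (Equiv.ofBijective f hf).apply_symm_apply w
  rw [k, k]

theorem frame_exists (C0 C1 : Set (Frame Unit))
    (h0iso : ClosedUnderIso C0) (h0du : ClosedUnderDU C0)
    (h1iso : ClosedUnderIso C1) (h1du : ClosedUnderDU C1)
    (hfork : HasFork C0) (hedge : HasEdge C1) :
    ∃ (Reg : Type) (mid : Bool → Reg) (R : Fin 2 → Wd Reg → Wd Reg → Prop),
      (⟨Wd Reg, R⟩ : Frame (Fin 2)) ∈ fusion2 C0 C1 ∧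
      (∀ n n' i, R 0 (Sum.inl n) (Sum.inr (n', mid i)) ↔ n' = n) ∧
      (∀ n i k, R 1 (Sum.inr (n, mid i)) (Sum.inl k) ↔ k = 2 * n + i.toNat) ∧
      (∀ x y, R 0 x y → c0 x = c0 y) ∧ (∀ x y, R 1 x y → c1 x = c1 y) := by
  classical
  obtain ⟨F0, hF0, w0, w1, w2, h01, h02, h12, r1, r2⟩ := hfork
  obtain ⟨F1, hF1, u0, u1, hu, ru⟩ := hedge
  have : Nonempty F0.World := ⟨w0⟩
  have : Nonempty F1.World := ⟨u0⟩
  let K := ℕ × F0.World × F1.World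
  have hA : Cardinal.mk F0.World ≤ Cardinal.mk K :=
    Cardinal.mk_le_of_injective (f := fun w => ((0, w, u0) : K)) (fun a b h => by
      have h' := congrArg (fun t : K => t.2.1) h; exact h')
  have hB : Cardinal.mk F1.World ≤ Cardinal.mk K :=
    Cardinal.mk_le_of_injective (f := fun w => ((0, w0, w) : K)) (fun a b h => by
      have h' := congrArg (fun t : K => t.2.2) h; exact h')
  obtain ⟨e0⟩ := beta_exists F0.World F1.World K w0 u1 hA hB
  let Reg := {p : Option K × F0.World // p ≠ (none, w0)}
  let Tgt := {p : (Bool ⊕ K) × F1.World // ∀ i, p ≠ (Sum.inl i, u1)}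
  let mid : Bool → Reg := fun i => ⟨(none, if i then w2 else w1), by
    cases i <;> simp [Ne.symm h01, Ne.symm h02]⟩
  let tg : Bool → Tgt := fun i => ⟨(Sum.inl i, u0), by
    intro j; simp [hu]⟩
  obtain ⟨β, hβ⟩ := fix_two (A := Reg) (B := Tgt) e0 mid tg (by
    intro h
    have := congrArg (fun x : Reg => x.1.2) h
    exact h12 (by simpa [mid] using this)) (by
    intro h
    have := congrArg (fun x : Tgt => x.1.1) h
    simp [tg] at this)
  let f0 : Wd Reg → (Σ _ : ℕ × Option K, F0.World) := fun x => match x with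
    | Sum.inl n => ⟨(n, none), w0⟩
    | Sum.inr (n, r) => ⟨(n, r.1.1), r.1.2⟩
  let f1 : Wd Reg → (Σ _ : ℕ × (Bool ⊕ K), F1.World) := fun x => match x with
    | Sum.inl k => ⟨(k / 2, Sum.inl (k % 2 == 1)), u1⟩
    | Sum.inr (n, r) => ⟨(n, (β r).1.1), (β r).1.2⟩
  have b0 : Function.Bijective f0 := by
    constructor
    · rintro (n | ⟨n, ⟨⟨r1, r2⟩, hr⟩⟩) (n' | ⟨n', ⟨⟨r1', r2'⟩, hr'⟩⟩) h
      · simp [f0] at h; rw [h]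
      · simp [f0] at h
        exact absurd (by simp [h]) hr'
      · simp [f0] at h
        exact absurd (by simp [h]) hr
      · simp [f0] at h
        simp [h]
    · rintro ⟨⟨n, k⟩, w⟩
      by_cases h : (k, w) = (none, w0)
      · refine ⟨Sum.inl n, ?_⟩
        simp only [Prod.mk.injEq] at h
        simp [f0, h]
      · exact ⟨Sum.inr (n, ⟨(k, w), h⟩), rfl⟩
  have b1 : Function.Bijective f1 := by
    constructor
    · rintro (n | ⟨n, r⟩) (n' | ⟨n', r'⟩) h
      · simp [f1] at h
        have : n = n' := by
          by_cases h1 : n % 2 = 1 <;> by_cases h2 : n' % 2 = 1 <;> simp [h1, h2] at h <;> omega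
        rw [this]
      · simp [f1] at h
        exact absurd (Prod.ext h.1.2.symm h.2.symm) ((β r').2 _)
      · simp [f1] at h
        exact absurd (Prod.ext h.1.2 h.2) ((β r).2 _)
      · simp only [f1, Sigma.mk.injEq, Prod.mk.injEq, heq_eq_eq] at h
        have : r = r' := β.injective (Subtype.ext (Prod.ext h.1.2 h.2))
        rw [h.1.1, this]
    · rintro ⟨⟨n, k⟩, w⟩
      by_cases h : ∃ i, (k, w) = (Sum.inl i, u1)
      · obtain ⟨i, hi⟩ := h
        simp only [Prod.mk.injEq] at hi
        obtain ⟨rfl, rfl⟩ := hi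
        refine ⟨Sum.inl (2 * n + i.toNat), ?_⟩
        cases i
        · simp [f1]
        · have : (2 * n + 1) / 2 = n := by omega
          simp [f1, this]
      · push Not at h
        refine ⟨Sum.inr (n, β.symm ⟨(k, w), h⟩), ?_⟩
        simp [f1]
  let R : Fin 2 → Wd Reg → Wd Reg → Prop := fun i x y =>
    if i = 0 then (Frame.disjUnion (fun _ : ℕ × Option K => F0)).R () (f0 x) (f0 y)
    else (Frame.disjUnion (fun _ : ℕ × (Bool ⊕ K) => F1)).R () (f1 x) (f1 y)
  have R0 : ∀ x y, R 0 x y ↔ (f0 x).1 = (f0 y).1 ∧ F0.R () (f0 x).2 (f0 y).2 :=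
    fun x y => disjUnion_const F0 (f0 x) (f0 y)
  have R1 : ∀ x y, R 1 x y ↔ (f1 x).1 = (f1 y).1 ∧ F1.R () (f1 x).2 (f1 y).2 :=
    fun x y => disjUnion_const F1 (f1 x) (f1 y)
  refine ⟨Reg, mid, R, ⟨?_, ?_⟩, ?_, ?_, ?_, ?_⟩
  · exact h0iso _ (h0du _ (fun _ : ℕ × Option K => F0) fun _ => hF0) _
      (iso_of_bij f0 b0 fun x y => Iff.rfl)
  · exact h1iso _ (h1du _ (fun _ : ℕ × (Bool ⊕ K) => F1) fun _ => hF1) _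
      (iso_of_bij f1 b1 fun x y => Iff.rfl)
  · intro n n' i
    refine (R0 (Sum.inl n) (Sum.inr (n', mid i))).trans ?_
    cases i <;> simp [f0, mid, r1, r2, eq_comm]
  · intro n i k
    refine (R1 (Sum.inr (n, mid i)) (Sum.inl k)).trans ?_
    simp only [f1, hβ]
    simp only [tg, ru, and_true, Prod.mk.injEq, Sum.inl.injEq]
    cases i <;> simp <;> omega
  · intro x y h
    replace h := (R0 x y).1 h
    have := congrArg Prod.fst h.1
    rcases x with n | ⟨n, r⟩ <;> rcases y with n' | ⟨n', r'⟩ <;> exact this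
  · intro x y h
    replace h := (R1 x y).1 h
    have := congrArg Prod.fst h.1
    rcases x with n | ⟨n, r⟩ <;> rcases y with n' | ⟨n', r'⟩ <;> exact this

end AH

namespace AH

open MuForm

theorem F1_mono_C {S : Type} (nu : ℕ → Prop) {m : ℕ} {C : Set S} {F : (ℕ → Set S) → Set S}
    (hF : MB m F) {X X' : ℕ → Set S} (h : ∀ j < m, ∀ s ∈ C, s ∈ X j → s ∈ X' j) :
    F1 nu m C F X ⊆ F1 nu m C F X' := by
  apply hF
  intro j hj s hs
  have mixm : ∀ j < m, ∀ {Y Y' : Set S}, Y ⊆ Y' → mix C (X j) Y ⊆ mix C (X' j) Y' := by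
    rintro j hj Y Y' hY s (⟨h1, h2⟩ | ⟨h1, h2⟩)
    · exact Or.inl ⟨h1, h j hj s h1 h2⟩
    · exact Or.inr ⟨h1, hY h2⟩
  refine mixm j hj ?_ hs
  intro s' hs'
  refine Sol_sim nu (F2_MB hF X) (F2_MB hF X') {t | t.2 < m} id ?_ (s', j) hj hs'
  intro Y' Y hY t ht
  apply hF
  intro i hi
  apply mixm _ (max_lt hi ht)
  intro s hs
  exact hY i hi (s, max i t.2) (max_lt hi ht) hs

def isLit {Λ Q : Type} : ANode Λ Q → Prop
  | .lit _ => True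
  | .nlit _ => True
  | _ => False

theorem holds_local {Q W : Type} {M M' : KModel (Fin 2) W} (hR : M.R = M'.R)
    (env : ℕ → Set W) {X Y : Set (Q × W)} (w : W) (nd : ANode (Fin 2) Q)
    (hV : isLit nd → ∀ p, w ∈ M.V p ↔ w ∈ M'.V p)
    (h : ∀ q v, (v = w ∨ M.R 0 w v ∨ M.R 1 w v) → (q, v) ∈ X → (q, v) ∈ Y)
    (hh : holds M env X w nd) : holds M' env Y w nd := by
  have hi : ∀ i : Fin 2, ∀ v, M.R i w v → M.R 0 w v ∨ M.R 1 w v := by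
    intro i v hv
    fin_cases i
    · exact Or.inl hv
    · exact Or.inr hv
  cases nd with
  | lit p => exact (hV trivial p).1 hh
  | nlit p => exact fun h' => hh ((hV trivial p).2 h')
  | var x => exact hh
  | and a b => exact ⟨h _ _ (Or.inl rfl) hh.1, h _ _ (Or.inl rfl) hh.2⟩
  | or a b => exact hh.imp (fun t => h _ _ (Or.inl rfl) t) (fun t => h _ _ (Or.inl rfl) t)
  | box i a =>
    intro v hv
    rw [← hR] at hv
    exact h _ _ (Or.inr (hi i v hv)) (hh v hv)
  | dia i a =>
    obtain ⟨v, hv, h'⟩ := hh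
    exact ⟨v, hR ▸ hv, h _ _ (Or.inr (hi i v hv)) h'⟩

def Vl {Reg : Type} (mid : Bool → Reg) (l : ℕ → Set ℕ) : ℕ → Set (Wd Reg) := fun p =>
  {x | match x with
    | Sum.inl n => p ∈ l n
    | Sum.inr r => p = 0 ∧ ∃ i, r.2 = mid i}

def Md {Reg : Type} (mid : Bool → Reg) (R : Fin 2 → Wd Reg → Wd Reg → Prop) (l : ℕ → Set ℕ) :
    KModel (Fin 2) (Wd Reg) := ⟨R, Vl mid l⟩

def Cn (Q Reg : Type) : Set (Q × Wd Reg) := {t | ∃ n, t.2 = Sum.inl n}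

def liftX {Q Reg : Type} (X : ℕ → Set (Q × ℕ)) : ℕ → Set (Q × Wd Reg) := fun j =>
  {t | ∃ n, t.2 = Sum.inl n ∧ (t.1, n) ∈ X j}

def stp {Q Reg : Type} (mid : Bool → Reg) (R : Fin 2 → Wd Reg → Wd Reg → Prop) 
    (δ : Q → ANode (Fin 2) Q) (Ω : Q → ℕ) (l : ℕ → Set ℕ) :=
  step (Md mid R l) (fun _ => Set.univ) δ Ω

noncomputable def FT {Q Reg : Type} (m : ℕ) (mid : Bool → Reg) (R : Fin 2 → Wd Reg → Wd Reg → Prop) 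
    (δ : Q → ANode (Fin 2) Q) (Ω : Q → ℕ) (l : ℕ → Set ℕ) : (ℕ → Set (Q × ℕ)) → Set (Q × ℕ) :=
  fun X => {s | (s.1, Sum.inl s.2) ∈ F1 Even m (Cn Q Reg) (stp mid R δ Ω l) (liftX X)}

section
variable {Q Reg : Type} {m : ℕ} {mid : Bool → Reg} {R : Fin 2 → Wd Reg → Wd Reg → Prop} 
    {δ : Q → ANode (Fin 2) Q} {Ω : Q → ℕ}

theorem stp_MB (hΩ : ∀ q, Ω q < m) (l : ℕ → Set ℕ) : MB m (stp mid R δ Ω l) := step_MB _ _ _ hΩ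

theorem FT_MB (hΩ : ∀ q, Ω q < m) (l : ℕ → Set ℕ) : MB m (FT m mid R δ Ω l) := by
  intro X Y h s hs
  refine F1_mono_C Even (stp_MB hΩ l) ?_ hs
  rintro j hj t - ⟨n, h1, h2⟩
  exact ⟨n, h1, h j hj h2⟩

theorem FT_sol (hΩ : ∀ q, Ω q < m) (l : ℕ → Set ℕ) (q : Q) (n : ℕ) :
    (q, Sum.inl n) ∈ Sol Even m (stp mid R δ Ω l) ↔ (q, n) ∈ Sol Even m (FT m mid R δ Ω l) := by
  rw [collapse Even (Cn Q Reg) (stp_MB hΩ l) (q, Sum.inl n) ⟨n, rfl⟩]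
  refine Sol_bisim Even (FT_MB hΩ l) (F1_MB Even (stp_MB hΩ l)) (Cn Q Reg)
    (fun t => (t.1, c0 t.2)) ?_ (q, Sum.inl n) ⟨n, rfl⟩
  rintro X' X hX ⟨q, w⟩ ⟨n, hn⟩
  simp only at hn
  subst hn
  show _ ↔ (q, (Sum.inl n : Wd Reg)) ∈ F1 Even m (Cn Q Reg) (stp mid R δ Ω l) (liftX X)
  constructor
  · intro h
    refine F1_mono_C Even (stp_MB hΩ l) ?_ h
    rintro j hj ⟨q', w'⟩ ⟨n', hn'⟩ h'
    simp only at hn'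
    subst hn'
    exact ⟨n', rfl, (hX j hj _ ⟨n', rfl⟩).1 h'⟩
  · intro h
    refine F1_mono_C Even (stp_MB hΩ l) ?_ h
    rintro j hj ⟨q', w'⟩ - ⟨n', hn', h'⟩
    simp only at hn'
    subst hn'
    exact (hX j hj _ ⟨n', rfl⟩).2 h'

theorem FT_lit (l : ℕ → Set ℕ) (X : ℕ → Set (Q × ℕ)) {q : Q} {p n : ℕ} (h : δ q = .lit p) :
    (q, n) ∈ FT m mid R δ Ω l X ↔ p ∈ l n := by
  show holds _ _ _ _ (δ q) ↔ _
  rw [h]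
  rfl

theorem FT_nlit (l : ℕ → Set ℕ) (X : ℕ → Set (Q × ℕ)) {q : Q} {p n : ℕ} (h : δ q = .nlit p) :
    (q, n) ∈ FT m mid R δ Ω l X ↔ p ∉ l n := by
  show holds _ _ _ _ (δ q) ↔ _
  rw [h]
  rfl

theorem FT_local (hΩ : ∀ q, Ω q < m) (hc0 : ∀ x y, R 0 x y → c0 x = c0 y)
    (hc1 : ∀ x y, R 1 x y → c1 x = c1 y) (l l' : ℕ → Set ℕ) (X X' : ℕ → Set (Q × ℕ)) (q : Q) (n : ℕ)
    (hq : ¬ isLit (δ q))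
    (h : ∀ j < m, ∀ q' n', n' ≤ 2 * n + 1 → (q', n') ∈ X j → (q', n') ∈ X' j)
    (hh : (q, n) ∈ FT m mid R δ Ω l X) : (q, n) ∈ FT m mid R δ Ω l' X' := by
  have reg : ∀ q n0 r j, j < m → n0 ≤ n →
      ((q, Sum.inr (n0, r)), j) ∈ Sol Even m (F2 (Cn Q Reg) (stp mid R δ Ω l) (liftX X)) →
      ((q, Sum.inr (n0, r)), j) ∈ Sol Even m (F2 (Cn Q Reg) (stp mid R δ Ω l') (liftX X')) := by
    intro q n0 r j hj hn
    refine Sol_sim Even (F2_MB (stp_MB hΩ l) _) (F2_MB (stp_MB hΩ l') _)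
      {t | t.2 < m ∧ ∃ n0 ≤ n, ∃ r, t.1.2 = Sum.inr (n0, r)} id ?_ _ ⟨hj, n0, hn, r, rfl⟩
    rintro Y' Y hY ⟨⟨q, w⟩, j⟩ ⟨hj, n0, hn, r, hr⟩ h1
    simp only at hr hj
    subst hr
    refine holds_local (M := Md mid R l) rfl _ _ _ (fun _ _ => Iff.rfl) ?_ h1
    intro q' v hv
    have hM : max (Ω q) j < m := max_lt (hΩ q) hj
    rcases v with n1 | ⟨n1, r1⟩
    · have hn1 : n1 ≤ 2 * n + 1 := by
        rcases hv with hv | hv | hv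
        · cases hv
        · have : c0 (Sum.inr (n0, r) : Wd Reg) = c0 (Sum.inl n1 : Wd Reg) := hc0 _ _ hv
          simp only [c0] at this
          omega
        · have : c1 (Sum.inr (n0, r) : Wd Reg) = c1 (Sum.inl n1 : Wd Reg) := hc1 _ _ hv
          simp only [c1] at this
          omega
      intro h2
      have hC : ((q', Sum.inl n1) : Q × Wd Reg) ∈ Cn Q Reg := ⟨n1, rfl⟩
      rw [mix_pos hC] at h2 ⊢
      obtain ⟨n2, h3, h4⟩ := h2
      cases h3
      exact ⟨n1, rfl, h _ hM _ _ hn1 h4⟩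
    · have hn1 : n1 ≤ n := by
        rcases hv with hv | hv | hv
        · cases hv; omega
        · have : c0 (Sum.inr (n0, r) : Wd Reg) = c0 (Sum.inr (n1, r1) : Wd Reg) := hc0 _ _ hv
          simp only [c0] at this
          omega
        · have : c1 (Sum.inr (n0, r) : Wd Reg) = c1 (Sum.inr (n1, r1) : Wd Reg) := hc1 _ _ hv
          simp only [c1] at this
          omega
      intro h2
      have hC : ((q', Sum.inr (n1, r1)) : Q × Wd Reg) ∉ Cn Q Reg := by rintro ⟨_, h⟩; cases h
      rw [mix_neg hC] at h2 ⊢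
      exact hY _ (hΩ q) ((q', Sum.inr (n1, r1)), max (Ω q) j) ⟨hM, n1, hn1, r1, rfl⟩ h2
  refine holds_local (M := Md mid R l) (M' := Md mid R l') rfl _ _ _ (fun h => absurd h hq) ?_ hh
  intro q' v hv
  rcases v with n1 | ⟨n1, r1⟩
  · have hn1 : n1 ≤ 2 * n + 1 := by
      rcases hv with hv | hv | hv
      · cases hv; omega
      · have : c0 (Sum.inl n : Wd Reg) = c0 (Sum.inl n1 : Wd Reg) := hc0 _ _ hv
        simp only [c0] at this
        omega
      · have : c1 (Sum.inl n : Wd Reg) = c1 (Sum.inl n1 : Wd Reg) := hc1 _ _ hv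
        simp only [c1] at this
        omega
    intro h2
    have hC : ((q', Sum.inl n1) : Q × Wd Reg) ∈ Cn Q Reg := ⟨n1, rfl⟩
    rw [mix_pos hC] at h2 ⊢
    obtain ⟨n2, h3, h4⟩ := h2
    cases h3
    exact ⟨n1, rfl, h _ (hΩ q) _ _ hn1 h4⟩
  · have hn1 : n1 ≤ n := by
      rcases hv with hv | hv | hv
      · cases hv
      · have : c0 (Sum.inl n : Wd Reg) = c0 (Sum.inr (n1, r1) : Wd Reg) := hc0 _ _ hv
        simp only [c0] at this
        omega
      · have : c1 (Sum.inl n : Wd Reg) = c1 (Sum.inr (n1, r1) : Wd Reg) := hc1 _ _ hv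
        simp only [c1] at this
        omega
    intro h2
    have hC : ((q', Sum.inr (n1, r1)) : Q × Wd Reg) ∉ Cn Q Reg := by rintro ⟨_, h⟩; cases h
    rw [mix_neg hC] at h2 ⊢
    exact reg _ _ _ _ (hΩ q) hn1 h2

end

/-- Tasks. -/
inductive Tk (Q : Type) : Type where
  | pos : Q → ℕ → Tk Q
  | tt : Tk Q
  | ff : Tk Q
  | or : Tk Q → Tk Q → Tk Q
  | and : Tk Q → Tk Q → Tk Q
  | atom : ℕ → Q → ℕ → Tk Q

def evT {Q : Type} (S : Set (ℕ × Q × ℕ)) : Tk Q → Prop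
  | .pos _ _ => False
  | .tt => True
  | .ff => False
  | .or a b => evT S a ∨ evT S b
  | .and a b => evT S a ∧ evT S b
  | .atom j q n => (j, q, n) ∈ S

def okT {Q : Type} (A : Set (ℕ × Q × ℕ)) : Tk Q → Prop
  | .pos _ _ => False
  | .tt => True
  | .ff => True
  | .or a b => okT A a ∧ okT A b
  | .and a b => okT A a ∧ okT A b
  | .atom j q n => (j, q, n) ∈ A

theorem okT_mono {Q : Type} {A B : Set (ℕ × Q × ℕ)} (h : A ⊆ B) (t : Tk Q) (ht : okT A t) :
    okT B t := by
  induction t with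
  | pos => exact ht
  | tt => trivial
  | ff => trivial
  | or a b iha ihb => exact ⟨iha ht.1, ihb ht.2⟩
  | and a b iha ihb => exact ⟨iha ht.1, ihb ht.2⟩
  | atom j q n => exact h ht

theorem exists_term {Q : Type} {A : Set (ℕ × Q × ℕ)} (hA : A.Finite) :
    ∀ h : Set (ℕ × Q × ℕ) → Prop, (∀ S S', (∀ a ∈ A, a ∈ S → a ∈ S') → h S → h S') →
      ∃ t : Tk Q, okT A t ∧ ∀ S, h S ↔ evT S t := by
  induction A, hA using Set.Finite.induction_on with
  | empty =>
    intro h hh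
    by_cases h0 : h ∅
    · exact ⟨.tt, trivial, fun S => iff_of_true (hh ∅ S (by simp) h0) trivial⟩
    · exact ⟨.ff, trivial, fun S => iff_of_false (fun h1 => h0 (hh S ∅ (by simp) h1)) id⟩
  | @insert a A ha hA ih =>
    intro h hh
    obtain ⟨t0, o0, e0⟩ := ih (fun S => h (S \ {a})) (by
      intro S S' hS
      apply hh
      rintro b (rfl | hb) ⟨h1, h2⟩
      · exact absurd rfl h2
      · exact ⟨hS b hb h1, h2⟩)
    obtain ⟨t1, o1, e1⟩ := ih (fun S => h (insert a S)) (by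
      intro S S' hS
      apply hh
      rintro b (rfl | hb) (h1 | h1)
      · exact Or.inl h1
      · exact Or.inl rfl
      · exact Or.inl h1
      · exact Or.inr (hS b hb h1))
    obtain ⟨j, q, n⟩ := a
    refine ⟨.or t0 (.and (.atom j q n) t1), ⟨okT_mono (Set.subset_insert _ _) _ o0,
      Set.mem_insert _ _, okT_mono (Set.subset_insert _ _) _ o1⟩, ?_⟩
    intro S
    show _ ↔ evT S t0 ∨ ((j, q, n) ∈ S ∧ evT S t1)
    rw [← e0, ← e1]
    constructor
    · intro h1
      by_cases hS : (j, q, n) ∈ S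
      · right
        exact ⟨hS, hh _ _ (fun b _ hb => Or.inr hb) h1⟩
      · left
        refine hh _ _ (fun b _ hb => ⟨hb, ?_⟩) h1
        rintro rfl
        exact hS hb
    · rintro (h1 | ⟨hS, h1⟩)
      · exact hh _ _ (fun b _ hb => hb.1) h1
      · refine hh _ _ (fun b _ hb => ?_) h1
        rcases hb with rfl | hb
        · exact hS
        · exact hb

def Xs {Q : Type} (X : ℕ → Set (Q × ℕ)) : Set (ℕ × Q × ℕ) := {a | (a.2.1, a.2.2) ∈ X a.1}

def At (Q : Type) (m B : ℕ) : Set (ℕ × Q × ℕ) := {a | a.1 < m ∧ a.2.2 ≤ B}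

theorem At_finite (Q : Type) [Finite Q] (m B : ℕ) : (At Q m B).Finite := by
  have : At Q m B = (Set.Iio m) ×ˢ (Set.univ ×ˢ Set.Iic B) := by
    ext a; simp [At]
  rw [this]
  exact (Set.finite_Iio m).prod (Set.finite_univ.prod (Set.finite_Iic B))

theorem expand_exists {Q Reg : Type} [Finite Q] {m : ℕ} {mid : Bool → Reg}
    {R : Fin 2 → Wd Reg → Wd Reg → Prop}
    {δ : Q → ANode (Fin 2) Q} {Ω : Q → ℕ} (hΩ : ∀ q, Ω q < m)
    (hc0 : ∀ x y, R 0 x y → c0 x = c0 y)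
    (hc1 : ∀ x y, R 1 x y → c1 x = c1 y) :
    ∃ E : Q → ℕ → Tk Q, ∀ q n, okT (At Q m (2 * n + 1)) (E q n) ∧ (¬ isLit (δ q) → ∀ l X,
      (q, n) ∈ FT m mid R δ Ω l X ↔ evT (Xs X) (E q n)) := by
  have : ∀ q n, ∃ t : Tk Q, okT (At Q m (2 * n + 1)) t ∧ (¬ isLit (δ q) → ∀ l X,
      (q, n) ∈ FT m mid R δ Ω l X ↔ evT (Xs X) t) := by
    intro q n
    by_cases hq : isLit (δ q)
    · exact ⟨.tt, trivial, fun h => absurd hq h⟩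
    obtain ⟨t, h1, h2⟩ := exists_term (At_finite Q m (2 * n + 1))
      (fun S => (q, n) ∈ FT m mid R δ Ω (fun _ => ∅) (fun j => {s | (j, s.1, s.2) ∈ S})) (by
        intro S S' hS
        apply FT_local hΩ hc0 hc1 _ _ _ _ _ _ hq
        intro j hj q' n' hn' h
        exact hS _ ⟨hj, hn'⟩ h)
    refine ⟨t, h1, fun _ l X => ?_⟩
    rw [← h2]
    constructor
    · exact FT_local hΩ hc0 hc1 _ _ _ _ _ _ hq (fun j hj q' n' hn' h => h)
    · exact FT_local hΩ hc0 hc1 _ _ _ _ _ _ hq (fun j hj q' n' hn' h => h)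
  choose E hE using this
  exact ⟨E, hE⟩

end AH

namespace AH

open MuForm

def litT {Λ Q : Type} : ANode Λ Q → Set ℕ → Prop
  | .lit p, S => p ∈ S
  | .nlit p, S => p ∉ S
  | _, _ => False

def FKp {Q : Type} (m : ℕ) (δ : Q → ANode (Fin 2) Q) (E : Q → ℕ → Tk Q) (l : ℕ → Set ℕ)
    (X : ℕ → Set (Tk Q)) : Tk Q → Prop
  | .pos q n => (isLit (δ q) ∧ litT (δ q) (l n)) ∨ (¬ isLit (δ q) ∧ E q n ∈ X 0)
  | .tt => True
  | .ff => False
  | .or a b => a ∈ X 0 ∨ b ∈ X 0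
  | .and a b => a ∈ X 0 ∧ b ∈ X 0
  | .atom j q n => j < m ∧ Tk.pos q n ∈ X j

def FK {Q : Type} (m : ℕ) (δ : Q → ANode (Fin 2) Q) (E : Q → ℕ → Tk Q) (l : ℕ → Set ℕ) :
    (ℕ → Set (Tk Q)) → Set (Tk Q) := fun X => {t | FKp m δ E l X t}

def CP (Q : Type) : Set (Tk Q) := {t | ∃ q n, t = Tk.pos q n}

theorem not_CP {Q : Type} {A : Set (ℕ × Q × ℕ)} {t : Tk Q} (h : okT A t) : t ∉ CP Q := by
  rintro ⟨q, n, rfl⟩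
  exact h

section
variable {Q Reg : Type} {m : ℕ} {mid : Bool → Reg} {R : Fin 2 → Wd Reg → Wd Reg → Prop}
    {δ : Q → ANode (Fin 2) Q} {Ω : Q → ℕ} {E : Q → ℕ → Tk Q} {l : ℕ → Set ℕ}

theorem FK_MB (hm : 0 < m) : MB m (FK m δ E l) := by
  intro X Y h t ht
  cases t with
  | pos q n => exact Or.imp id (fun x => ⟨x.1, h 0 hm x.2⟩) ht
  | tt => exact ht
  | ff => exact ht
  | or a b => exact Or.imp (fun x => h 0 hm x) (fun x => h 0 hm x) ht
  | and a b => exact ⟨h 0 hm ht.1, h 0 hm ht.2⟩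
  | atom j q n => exact ⟨ht.1, h j ht.1 ht.2⟩

theorem FK_eval (hm : 0 < m) (X : ℕ → Set (Tk Q)) {B : ℕ} (j : ℕ) (t : Tk Q)
    (ht : okT (At Q m B) t) :
    (t, j) ∈ Sol Even m (F2 (CP Q) (FK m δ E l) X) ↔
      evT {a | Tk.pos a.2.1 a.2.2 ∈ X (max a.1 j)} t := by
  have hun : ∀ t, (t, j) ∈ Sol Even m (F2 (CP Q) (FK m δ E l) X) ↔
      FKp m δ E l (fun i => mix (CP Q) (X (max i j))
        {s' | (s', max i j) ∈ Sol Even m (F2 (CP Q) (FK m δ E l) X)}) t := by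
    intro t
    conv_lhs => rw [Sol_unfold Even (F2_MB (FK_MB hm) X)]
    rfl
  have h0 : max 0 j = j := by simp
  induction t with
  | pos => exact ht.elim
  | tt => rw [hun]; rfl
  | ff => rw [hun]; rfl
  | or a b iha ihb =>
    rw [hun]
    simp only [FKp, evT, mix_neg (not_CP ht.1), mix_neg (not_CP ht.2), Set.mem_setOf_eq, h0]
    exact or_congr (iha ht.1) (ihb ht.2)
  | and a b iha ihb =>
    rw [hun]
    simp only [FKp, evT, mix_neg (not_CP ht.1), mix_neg (not_CP ht.2), Set.mem_setOf_eq, h0]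
    exact and_congr (iha ht.1) (ihb ht.2)
  | atom i q n =>
    rw [hun]
    have hC : Tk.pos q n ∈ CP Q := ⟨q, n, rfl⟩
    simp only [FKp, evT, mix_pos hC, Set.mem_setOf_eq]
    exact and_iff_right ht.1

theorem evT_congr {A S S' : Set (ℕ × Q × ℕ)} (h : ∀ a ∈ A, a ∈ S ↔ a ∈ S') (t : Tk Q)
    (ht : okT A t) : evT S t ↔ evT S' t := by
  induction t with
  | pos => exact ht.elim
  | tt => rfl
  | ff => rfl
  | or a b iha ihb => exact or_congr (iha ht.1) (ihb ht.2)
  | and a b iha ihb => exact and_congr (iha ht.1) (ihb ht.2)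
  | atom i q n => exact h _ ht

def unpos (q0 : Q) : Tk Q → Q × ℕ
  | .pos q n => (q, n)
  | _ => (q0, 0)

theorem FK_sol (hm : 0 < m) (hΩ : ∀ q, Ω q < m)
    (hE : ∀ q n, okT (At Q m (2 * n + 1)) (E q n) ∧ (¬ isLit (δ q) → ∀ l X,
      (q, n) ∈ FT m mid R δ Ω l X ↔ evT (Xs X) (E q n))) (q : Q) (n : ℕ) :
    Tk.pos q n ∈ Sol Even m (FK m δ E l) ↔ (q, n) ∈ Sol Even m (FT m mid R δ Ω l) := by
  have hC : ∀ q n, Tk.pos q n ∈ CP Q := fun q n => ⟨q, n, rfl⟩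
  rw [collapse Even (CP Q) (FK_MB hm) _ (hC q n)]
  refine Sol_bisim Even (FT_MB hΩ l) (F1_MB Even (FK_MB hm)) (CP Q)
    (unpos q) ?_ (Tk.pos q n) (hC q n)
  rintro X' X hX _ ⟨q, n, rfl⟩
  show FKp m δ E l (fun j => mix (CP Q) (X' j)
    {s' | (s', j) ∈ Sol Even m (F2 (CP Q) (FK m δ E l) X')}) (Tk.pos q n) ↔ (q, n) ∈ FT m mid R δ Ω l X
  by_cases hq : isLit (δ q)
  · simp only [FKp, hq, true_and, not_true, false_and, or_false]
    cases hd : δ q with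
    | lit p => rw [FT_lit l X hd]; rfl
    | nlit p => rw [FT_nlit l X hd]; rfl
    | _ => rw [hd] at hq; exact hq.elim
  · simp only [FKp, hq, not_false_eq_true, false_and, true_and, false_or]
    rw [(hE q n).2 hq, mix_neg (not_CP (hE q n).1), Set.mem_setOf_eq,
      FK_eval hm X' 0 _ (hE q n).1]
    refine evT_congr ?_ _ (hE q n).1
    rintro ⟨j, q', n'⟩ ⟨hj, -⟩
    have := hX j hj _ (hC q' n')
    simpa [Xs, unpos] using this

open Classical in
/-- children -/
noncomputable def child (δ : Q → ANode (Fin 2) Q) (E : Q → ℕ → Tk Q) (b : Bool) : Tk Q → Tk Q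
  | .or x y => cond b y x
  | .and x y => cond b y x
  | .atom _ q n => .pos q n
  | .pos q n => if isLit (δ q) then .tt else E q n
  | _ => .tt

noncomputable def tau (δ : Q → ANode (Fin 2) Q) (E : Q → ℕ → Tk Q) (q0 : Q) : ℕ → Tk Q
  | 0 => .tt
  | 1 => .atom 0 q0 1
  | k + 2 => child δ E (decide ((k + 2) % 2 = 1)) (tau δ E q0 ((k + 2) / 2))
decreasing_by omega

theorem tau_child (q0 : Q) (k : ℕ) (hk : 1 ≤ k) (b : Bool) :
    tau δ E q0 (2 * k + b.toNat) = child δ E b (tau δ E q0 k) := by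
  obtain ⟨j, hj⟩ : ∃ j, 2 * k + b.toNat = j + 2 := ⟨2 * k + b.toNat - 2, by omega⟩
  rw [hj, tau, ← hj]
  have hb : b.toNat < 2 := Bool.toNat_lt b
  have h1 : (2 * k + b.toNat) / 2 = k := by omega
  have h2 : (2 * k + b.toNat) % 2 = b.toNat := by omega
  rw [h1, h2]
  cases b <;> rfl

def Inv (m k : ℕ) : Tk Q → Prop
  | .pos _ n => 2 * n ≤ k
  | t => okT (At Q m k) t

theorem Inv_ok {k : ℕ} {t : Tk Q} (h : okT (At Q m k) t) : Inv m k t := by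
  cases t with
  | pos => exact h.elim
  | _ => exact h

theorem At_mono {k k' : ℕ} (h : k ≤ k') : At Q m k ⊆ At Q m k' := fun _ ha => ⟨ha.1, ha.2.trans h⟩

theorem tau_Inv (hm : 0 < m) (hE : ∀ q n, okT (At Q m (2 * n + 1)) (E q n)) (q0 : Q) (k : ℕ) :
    1 ≤ k → Inv m k (tau δ E q0 k) := by
  induction k using Nat.strong_induction_on with
  | _ k ih =>
    intro hk
    by_cases h1 : k = 1
    · subst h1
      rw [tau]
      exact ⟨hm, le_rfl⟩
    obtain ⟨j, b, hj⟩ : ∃ (j : ℕ) (b : Bool), k = 2 * j + b.toNat := by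
      rcases Nat.even_or_odd' k with ⟨j, h | h⟩
      · exact ⟨j, false, h⟩
      · exact ⟨j, true, h⟩
    have hb : b.toNat < 2 := Bool.toNat_lt b
    have hj1 : 1 ≤ j := by omega
    have hI := ih j (by omega) hj1
    rw [hj, tau_child q0 j hj1 b]
    have hjk : j ≤ 2 * j + b.toNat := by omega
    cases ht : tau δ E q0 j with
    | pos q n =>
      rw [ht] at hI
      change 2 * n ≤ j at hI
      simp only [child]
      split_ifs
      · trivial
      · exact Inv_ok (okT_mono (At_mono (by omega)) _ (hE q n))
    | tt => trivial
    | ff => trivial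
    | or x y =>
      rw [ht] at hI
      cases b
      · exact Inv_ok (okT_mono (At_mono hjk) _ hI.1)
      · exact Inv_ok (okT_mono (At_mono hjk) _ hI.2)
    | and x y =>
      rw [ht] at hI
      cases b
      · exact Inv_ok (okT_mono (At_mono hjk) _ hI.1)
      · exact Inv_ok (okT_mono (At_mono hjk) _ hI.2)
    | atom i q n =>
      rw [ht] at hI
      have : n ≤ j := hI.2
      show 2 * n ≤ _
      omega

def labT (δ : Q → ANode (Fin 2) Q) (g : ℕ → Set ℕ) : Tk Q → Set ℕ
  | .pos q n => {p | p = 1 ∨ (isLit (δ q) ∧ p = 2 ∧ litT (δ q) (g n)) ∨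
      (¬ isLit (δ q) ∧ (p = 3 ∨ p = 5))}
  | .tt => {p | p = 1 ∨ p = 2}
  | .ff => {p | p = 1}
  | .or _ _ => {p | p = 1 ∨ p = 3 ∨ p = 5}
  | .and _ _ => {p | p = 1 ∨ p = 4 ∨ p = 5}
  | .atom j _ _ => {p | p = 1 ∨ p = 3 ∨ p = 5 + j}

noncomputable def lab (δ : Q → ANode (Fin 2) Q) (t : ℕ → Tk Q) (k : ℕ) : Set ℕ :=
  labT δ (fun n => if _ : n < k then lab δ t n else ∅) (t k)
termination_by k

theorem labT_zero (g : ℕ → Set ℕ) (t : Tk Q) : 0 ∉ labT δ g t := by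
  cases t <;> simp [labT]
  omega

theorem labT_one (g : ℕ → Set ℕ) (t : Tk Q) : 1 ∈ labT δ g t := by
  cases t <;> simp [labT]

theorem body_lab
    (hR0 : ∀ n n' i, R 0 (Sum.inl n) (Sum.inr (n', mid i)) ↔ n' = n)
    (hR1 : ∀ n i k, R 1 (Sum.inr (n, mid i)) (Sum.inl k) ↔ k = 2 * n + i.toNat)
    (h0 : ∀ n, 0 ∉ l n) (h1 : ∀ n, 1 ∈ l n) (v : ℕ → Set (Wd Reg)) (k : ℕ) :
    Sum.inl k ∈ sem (Md mid R l) v (bodyF m) ↔ 2 ∈ l k ∨ ∃ j < m, 5 + j ∈ l k ∧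
      ((3 ∈ l k ∧ ∃ b : Bool, Sum.inl (2 * k + b.toNat) ∈ v j) ∨
       (4 ∈ l k ∧ ∀ b : Bool, Sum.inl (2 * k + b.toNat) ∈ v j)) := by
  rw [mem_bodyF]
  refine or_congr Iff.rfl (exists_congr fun j => and_congr Iff.rfl (and_congr Iff.rfl
    (or_congr (and_congr Iff.rfl ?_) (and_congr Iff.rfl ?_))))
  · constructor
    · rintro ⟨x, hx, hx0, y, hy, hy1, h⟩
      rcases x with n | ⟨n, r⟩
      · exact absurd hx0 (h0 n)
      obtain ⟨-, i, hi⟩ := hx0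
      simp only at hi
      subst hi
      rcases y with n' | r'
      · have e1 := (hR0 _ _ _).1 hx
        subst e1
        have e2 := (hR1 _ _ _).1 hy
        subst e2
        exact ⟨i, h⟩
      · exact absurd hy1.1 one_ne_zero
    · rintro ⟨b, h⟩
      exact ⟨Sum.inr (k, mid b), (hR0 _ _ _).2 rfl, ⟨rfl, b, rfl⟩, Sum.inl (2 * k + b.toNat),
        (hR1 _ _ _).2 rfl, h1 _, h⟩
  · constructor
    · intro h b
      exact h (Sum.inr (k, mid b)) ((hR0 _ _ _).2 rfl) ⟨rfl, b, rfl⟩ (Sum.inl (2 * k + b.toNat))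
        ((hR1 _ _ _).2 rfl) (h1 _)
    · intro h x hx hx0 y hy hy1
      rcases x with n | ⟨n, r⟩
      · exact absurd hx0 (h0 n)
      obtain ⟨-, i, hi⟩ := hx0
      simp only at hi
      subst hi
      rcases y with n' | r'
      · have e1 := (hR0 _ _ _).1 hx
        subst e1
        have e2 := (hR1 _ _ _).1 hy
        subst e2
        exact h i
      · exact absurd hy1.1 one_ne_zero

theorem diag (hm : 0 < m)
    (hR0 : ∀ n n' i, R 0 (Sum.inl n) (Sum.inr (n', mid i)) ↔ n' = n)
    (hR1 : ∀ n i k, R 1 (Sum.inr (n, mid i)) (Sum.inl k) ↔ k = 2 * n + i.toNat)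
    (hE : ∀ q n, okT (At Q m (2 * n + 1)) (E q n)) (q0 : Q) :
    ∃ l : ℕ → Set ℕ, (Sum.inl 1 ∈ Sol Even m (fun v => sem (Md mid R l) v (bodyF m)) ↔
      Tk.atom 0 q0 1 ∈ Sol Even m (FK m δ E l)) := by
  let t := tau δ E q0
  let l := lab δ t
  have hl : ∀ k, l k = labT δ (fun n => if _ : n < k then l n else ∅) (t k) := by
    intro k
    show lab δ t k = _
    rw [lab]
  have h0 : ∀ n, 0 ∉ l n := fun n => by rw [hl]; exact labT_zero _ _
  have h1 : ∀ n, 1 ∈ l n := fun n => by rw [hl]; exact labT_one _ _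
  refine ⟨l, ?_⟩
  have := Sol_bisim Even (FK_MB (δ := δ) (E := E) (l := l) hm) (body_MB (Md mid R l) m)
    {x | ∃ k, 1 ≤ k ∧ x = Sum.inl k} (fun x => t (c0 x)) ?_ (Sum.inl 1) ⟨1, le_rfl, rfl⟩
  · have e : t (c0 (Sum.inl 1 : Wd Reg)) = Tk.atom 0 q0 1 := by
      show tau δ E q0 1 = _
      rw [tau]
    rw [e] at this
    exact this
  rintro X' X hX _ ⟨k, hk, rfl⟩
  have hc : ∀ j < m, ∀ b : Bool, (Sum.inl (2 * k + b.toNat) ∈ X' j ↔ child δ E b (t k) ∈ X j) := by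
    intro j hj b
    rw [hX j hj _ ⟨2 * k + b.toNat, by omega, rfl⟩, ← tau_child q0 k hk b]
    rfl
  show Sum.inl k ∈ sem (Md mid R l) X' (bodyF m) ↔ FKp m δ E l X (t k)
  rw [body_lab hR0 hR1 h0 h1]
  have step1 : (2 ∈ l k ∨ ∃ j < m, 5 + j ∈ l k ∧
      ((3 ∈ l k ∧ ∃ b : Bool, Sum.inl (2 * k + b.toNat) ∈ X' j) ∨
       (4 ∈ l k ∧ ∀ b : Bool, Sum.inl (2 * k + b.toNat) ∈ X' j))) ↔
      (2 ∈ l k ∨ ∃ j < m, 5 + j ∈ l k ∧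
      ((3 ∈ l k ∧ ∃ b : Bool, child δ E b (t k) ∈ X j) ∨
       (4 ∈ l k ∧ ∀ b : Bool, child δ E b (t k) ∈ X j))) := by
    refine or_congr Iff.rfl (exists_congr fun j => and_congr_right fun hj => and_congr Iff.rfl ?_)
    simp only [hc j hj]
  rw [step1, hl k]
  have hI := tau_Inv (δ := δ) hm hE q0 k hk
  change Inv m k (t k) at hI
  have a1 : ∀ j, ¬ (5 + j = 1) := by omega
  have a3 : ∀ j, ¬ (5 + j = 3) := by omega
  have a4 : ∀ j, ¬ (5 + j = 4) := by omega
  have b2 : ∀ j, ¬ (2 = 5 + j) := by omega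
  have b4 : ∀ j, ¬ (4 = 5 + j) := by omega
  have hex : ∀ (i : ℕ) (P : ℕ → Prop), i < m → ((∃ j < m, j = i ∧ P j) ↔ P i) := by
    intro i P hi
    constructor
    · rintro ⟨j, _, rfl, h⟩
      exact h
    · exact fun h => ⟨i, hi, rfl, h⟩
  cases htk : t k with
  | pos q n =>
    rw [htk] at hI
    change 2 * n ≤ k at hI
    have hnk : n < k := by omega
    by_cases hq : isLit (δ q)
    · simp [labT, FKp, hq, hnk]
    · simp [labT, FKp, hq, child, a1, a3, a4, hex, hm]
  | tt => simp [labT, FKp]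
  | ff => simp [labT, FKp]
  | or x y => simp [labT, FKp, child, a1, a3, a4, hex, hm]
  | and x y => simp [labT, FKp, child, a1, a3, a4, hex, hm]
  | atom j q n =>
    rw [htk] at hI
    have hj : j < m := hI.1
    simp [labT, FKp, child, a1, a3, b2, b4, hex, hj]

end

theorem main (C0 C1 : Set (Frame Unit))
    (h0iso : ClosedUnderIso C0) (h0du : ClosedUnderDU C0)
    (h1iso : ClosedUnderIso C1) (h1du : ClosedUnderDU C1)
    (hfork : HasFork C0) (hedge : HasEdge C1) (n : ℕ) :
    ∃ φ : MuForm (Fin 2), (SigmaMu (n + 1) φ ∨ PiMu (n + 1) φ) ∧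
      ∀ ψ : MuForm (Fin 2), (SigmaMu n ψ ∨ PiMu n ψ) → ¬ EquivOver (fusion2 C0 C1) φ ψ := by
  refine ⟨WB (n + 1) (bodyF (n + 1)), ?_, ?_⟩
  · have := WB_class (bodyF (n + 1)) (noFix_bodyF _) (n + 1)
    by_cases h : Even (n + 1)
    · exact Or.inl (this.1 h)
    · exact Or.inr (this.2 h)
  intro ψ hψ heq
  obtain ⟨Reg, mid, R, hfr, hR0, hR1, hc0, hc1⟩ :=
    frame_exists C0 C1 h0iso h0du h1iso h1du hfork hedge
  obtain ⟨Q, hQ, q0, δ, Ω, hΩ, hco⟩ := coRep (nu := Even) (fun k => Nat.even_add_one) hψ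
  obtain ⟨E, hE⟩ := expand_exists (mid := mid) (R := R) (δ := δ) hΩ hc0 hc1
  have hm : 0 < n + 1 := Nat.succ_pos n
  obtain ⟨l, hl⟩ := diag (δ := δ) hm hR0 hR1 (fun q n => (hE q n).1) q0
  have h1 := heq _ hfr (Vl mid l) (fun _ => ∅)
  change sem (Md mid R l) (fun _ => ∅) _ = sem (Md mid R l) (fun _ => ∅) _ at h1
  rw [sem_WB] at h1
  change Sol Even (n + 1) _ = _ at h1
  have h2 := hco _ (Md mid R l) (Sum.inl 1)
  have h3 := FT_sol (mid := mid) (R := R) (δ := δ) hΩ l q0 1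
  have h4 := FK_sol (l := l) hm hΩ hE q0 1
  have h5 : Tk.atom 0 q0 1 ∈ Sol Even (n + 1) (FK (n + 1) δ E l) ↔
      Tk.pos q0 1 ∈ Sol Even (n + 1) (FK (n + 1) δ E l) := by
    conv_lhs => rw [Sol_unfold Even (FK_MB hm)]
    exact and_iff_right hm
  rw [h1] at hl
  rw [hl, h5, h4, ← h3] at h2
  exact not_iff_self h2

end AH

/-- If `∘←∘→∘` is a subframe of `F₀` and `∘→∘` is a subframe of
`F₁`, where `F₀`, `F₁` are classes of unimodal frames closed under isomorphic
copies and disjoint unions, then the μ-calculus' alternation hierarchy is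
strict over the fusion `F₀ ⊗ F₁`. -/
theorem alternation_hierarchy_strict_fork_edge
    (C0 C1 : Set (Frame Unit))
    (h0iso : ClosedUnderIso C0) (h0du : ClosedUnderDU C0)
    (h1iso : ClosedUnderIso C1) (h1du : ClosedUnderDU C1)
    (hfork : HasFork C0) (hedge : HasEdge C1) :
    ∀ n : ℕ, ∃ φ : MuForm (Fin 2), (SigmaMu (n + 1) φ ∨ PiMu (n + 1) φ) ∧
      ∀ ψ : MuForm (Fin 2), (SigmaMu n ψ ∨ PiMu n ψ) →
        ¬ EquivOver (fusion2 C0 C1) φ ψ := by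
  exact AH.main C0 C1 h0iso h0du h1iso h1du hfork hedge
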